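/- Let c, d be positive integers, n = c + d, and let λ/μ and ν/ρ be two skew shapes. Set α = cλ + dν and β = cμ + dρ (coordinatewise). Then ∏_{i=1}^{n} s_{α^{{i,n}}/β^{{i,n}}} − s_{λ/μ}^c · s_{ν/ρ}^d is Schur nonnegative. -/

import Mathlib

/-- The complete homogeneous symmetric function `h_m` in `N` variables,
with `h_m = 0` for `m < 0`. -/
noncomputable def homog (N : ℕ) (m : ℤ) : MvPolynomial (Fin N) ℤ :=
  if 0 ≤ m then MvPolynomial.hsymm (Fin N) ℤ m.toNat else 0

/-- The skew Schur polynomial `s_{λ/μ}` in `N` variables, given by the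
Jacobi–Trudi determinant `det (h_{λ_i - μ_j - i + j})_{i,j=1}^k`, where the
partitions `lam`, `mu` are recorded 0-indexed (`lam 0 = λ_1`). -/
noncomputable def skewSchur (N k : ℕ) (lam mu : ℕ → ℕ) : MvPolynomial (Fin N) ℤ :=
  Matrix.det (Matrix.of fun i j : Fin k =>
    homog N ((lam i : ℤ) - (mu j : ℤ) - (i : ℤ) + (j : ℤ)))

/-- A symmetric polynomial is Schur nonnegative if it is a linear combination
with nonnegative coefficients of Schur polynomials `s_λ`. -/
def IsSchurNonneg (N : ℕ) (f : MvPolynomial (Fin N) ℤ) : Prop :=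
  ∃ (m : ℕ) (c : Fin m → ℕ) (k : Fin m → ℕ) (lam : Fin m → ℕ → ℕ),
    (∀ i, Antitone (lam i)) ∧ (∀ i j, k i ≤ j → lam i j = 0) ∧
    f = ∑ i, (c i : ℤ) • skewSchur N (k i) (lam i) (fun _ => 0)

/-- The conjugate partition: `λ'_j = #{i : λ_i ≥ j}` (0-indexed:
`conjPart λ j = #{i : λ_i ≥ j + 1}`). -/
noncomputable def conjPart (lam : ℕ → ℕ) : ℕ → ℕ :=
  fun j => Set.ncard {i : ℕ | j + 1 ≤ lam i}

/-- The partition `λ^{{i,n}} := ((λ')^{[i,n]})'`, where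
`λ^{[i,n]} = (λ_i, λ_{i+n}, λ_{i+2n}, …)` (0-indexed `i : Fin n`). -/
noncomputable def braceQuot (n : ℕ) (i : Fin n) (lam : ℕ → ℕ) : ℕ → ℕ :=
  conjPart (fun j => conjPart lam (i + j * n))

namespace SB
open Finset

/-- Two-step interlacing. -/
def Inter (x y : ℕ → ℕ) : Prop := ∀ r, x r ≤ y r ∧ y (r + 2) ≤ x r

/-- Number of cells weakly after position `τ` in the reading order. -/
def Phi (K : ℕ) (x : ℕ → ℕ) (τ : ℕ) : ℕ := ∑ r ∈ range K, (x r - (τ + r) / K)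

lemma Phi_step (K : ℕ) (x : ℕ → ℕ) (s r : ℕ) (hr : r < K) :
    Phi K x (s * K + (K - 1 - r)) = Phi K x (s * K + (K - 1 - r) + 1) + if s < x r then 1 else 0 := by
  unfold Phi
  have h1 : (if s < x r then 1 else 0) = ∑ q ∈ range K, if q = r then (if s < x r then 1 else 0) else 0 := by
    rw [Finset.sum_ite_eq']; simp [hr]
  rw [h1, ← Finset.sum_add_distrib]
  apply Finset.sum_congr rfl
  intro q hq
  have hq := Finset.mem_range.1 hq
  have hK : 0 < K := by omega
  by_cases hqr : q = r
  · subst hqr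
    have e1 : (s * K + (K - 1 - q) + q) / K = s := by
      rw [Nat.div_eq_iff hK]; constructor
      · nlinarith
      · have : (s*K) + K = (s+1)*K := by ring
        omega
    have e2 : (s * K + (K - 1 - q) + 1 + q) / K = s + 1 := by
      have : s * K + (K - 1 - q) + 1 + q = (s+1)*K := by
        have : (s*K) + K = (s+1)*K := by ring
        omega
      rw [this, Nat.mul_div_cancel _ hK]
    rw [e1, e2]; simp; split_ifs <;> omega
  · have e : (s * K + (K - 1 - r) + q) / K = (s * K + (K - 1 - r) + 1 + q) / K := by
      rw [show s * K + (K - 1 - r) + q = (K - 1 - r + q) + s * K by ring,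
        show s * K + (K - 1 - r) + 1 + q = (K - 1 - r + q + 1) + s * K by ring,
        Nat.add_mul_div_right _ _ hK, Nat.add_mul_div_right _ _ hK]
      congr 1
      rcases Nat.lt_or_ge q r with h | h
      · rw [Nat.div_eq_of_lt (by omega), Nat.div_eq_of_lt (by omega)]
      · rw [Nat.div_eq_of_lt_le (k := 1) (by omega) (by omega), Nat.div_eq_of_lt_le (k := 1) (by omega) (by omega)]
    rw [e]; simp [hqr]

lemma pos_decomp (K : ℕ) (hK : 0 < K) (θ : ℕ) : ∃ s r, r < K ∧ θ = s * K + (K - 1 - r) := by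
  refine ⟨θ / K, K - 1 - θ % K, by omega, ?_⟩
  have := Nat.div_add_mod θ K
  have h2 := Nat.mod_lt θ hK
  rw [mul_comm] at this
  omega

lemma Inter.lt_le {t c : ℕ → ℕ} (h : Inter t c) {p q : ℕ} (hpq : p < q) (hm : p % 2 = q % 2) :
    c q ≤ t p := by
  obtain ⟨j, rfl⟩ : ∃ j, q = p + 2 + 2 * j := ⟨(q - p - 2) / 2, by omega⟩
  clear hpq hm
  induction j with
  | zero => exact (h p).2
  | succ j ih =>
    have h1 := (h (p + 2 + 2 * j)).2
    have h2 := (h (p + 2 + 2 * j)).1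
    have : p + 2 + 2 * (j + 1) = p + 2 + 2 * j + 2 := by ring
    rw [this]; omega

lemma win {K s r b q : ℕ} (hr : r < K) (hq : q < K)
    (h1 : s * K + (K - 1 - r) < b * K + (K - 1 - q))
    (h2 : b * K + (K - 1 - q) < s * K + (K - 1 - r) + K) :
    (s = b ∧ q < r) ∨ (s + 1 = b ∧ r < q) := by
  have hs : s ≤ b := by
    by_contra h
    have : (b + 1) * K ≤ s * K := Nat.mul_le_mul_right _ (by omega)
    have : (b + 1) * K = b * K + K := by ring
    omega
  have hs2 : b ≤ s + 1 := by
    by_contra h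
    have : (s + 2) * K ≤ b * K := Nat.mul_le_mul_right _ (by omega)
    have : (s + 2) * K = s * K + 2 * K := by ring
    omega
  rcases Nat.lt_or_ge s b with h | h
  · have : b = s + 1 := by omega
    subst this
    have : (s + 1) * K = s * K + K := by ring
    right; omega
  · have : b = s := by omega
    subst this
    left; omega

def tL (a c : ℕ → ℕ) (r : ℕ) : ℕ := max (c (r + 2)) (a r)
def tU (a c : ℕ → ℕ) (r : ℕ) : ℕ := if r < 2 then c r else min (c r) (a (r - 2))
/-- truncated Bender–Knuth toggle -/
def tog (K τ : ℕ) (a c t : ℕ → ℕ) (r : ℕ) : ℕ :=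
  if t r ≤ (τ + r) / K then tL a c r + min (tU a c r) ((τ + r) / K) - t r else t r

section local_
variable {K τ : ℕ} {a t c : ℕ → ℕ}

lemma tL_le (h1 : Inter a t) (h2 : Inter t c) (r : ℕ) : tL a c r ≤ t r :=
  max_le (h2 r).2 (h1 r).1

lemma le_tU (h1 : Inter a t) (h2 : Inter t c) (r : ℕ) : t r ≤ tU a c r := by
  unfold tU
  split_ifs with h
  · exact (h2 r).1
  · refine le_min (h2 r).1 ?_
    have := (h1 (r - 2)).2
    rwa [Nat.sub_add_cancel (by omega)] at this

lemma inter_of {x : ℕ → ℕ} (hL : ∀ r, tL a c r ≤ x r) (hU : ∀ r, x r ≤ tU a c r) :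
    Inter a x ∧ Inter x c := by
  constructor
  · intro r
    refine ⟨(le_max_right _ _).trans (hL r), ?_⟩
    have := hU (r + 2)
    unfold tU at this
    rw [if_neg (by omega)] at this
    exact this.trans (min_le_right _ _)
  · intro r
    refine ⟨?_, (le_max_left _ _).trans (hL r)⟩
    have := hU r
    unfold tU at this
    split_ifs at this
    · exact this
    · exact this.trans (min_le_left _ _)

lemma tog_bounds (h1 : Inter a t) (h2 : Inter t c) (r : ℕ) :
    tL a c r ≤ tog K τ a c t r ∧ tog K τ a c t r ≤ tU a c r := by
  have := tL_le h1 h2 r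
  have := le_tU h1 h2 r
  unfold tog
  split_ifs with h <;> omega

lemma tog_inter (h1 : Inter a t) (h2 : Inter t c) :
    Inter a (tog K τ a c t) ∧ Inter (tog K τ a c t) c :=
  inter_of (fun r => (tog_bounds h1 h2 r).1) (fun r => (tog_bounds h1 h2 r).2)

lemma tog_le_iff (h1 : Inter a t) (h2 : Inter t c) (r : ℕ) :
    tog K τ a c t r ≤ (τ + r) / K ↔ t r ≤ (τ + r) / K := by
  have := tL_le h1 h2 r
  have := le_tU h1 h2 r
  unfold tog
  split_ifs with h <;> omega

lemma tog_tog (h1 : Inter a t) (h2 : Inter t c) : tog K τ a c (tog K τ a c t) = t := by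
  funext r
  have := tL_le h1 h2 r
  have := le_tU h1 h2 r
  unfold tog
  split_ifs with h <;> omega

lemma tog_Phi (h1 : Inter a t) (h2 : Inter t c) {τ' : ℕ} (h : τ ≤ τ') :
    Phi K (tog K τ a c t) τ' = Phi K t τ' := by
  unfold Phi
  apply Finset.sum_congr rfl
  intro r _
  have h3 := tog_le_iff (K := K) (τ := τ) h1 h2 r
  have h4 : (τ + r) / K ≤ (τ' + r) / K := Nat.div_le_div_right (by omega)
  by_cases hh : t r ≤ (τ + r) / K
  · have := h3.2 hh; omega
  · unfold tog; rw [if_neg hh]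

end local_

/-- data of a first violation -/
structure Viol (K τ : ℕ) (a t c : ℕ → ℕ) : Prop where
  i1 : Inter a t
  i2 : Inter t c
  bad : 2 * Phi K t τ < Phi K c τ + Phi K a τ
  good : ∀ τ', τ < τ' → Phi K c τ' + Phi K a τ' ≤ 2 * Phi K t τ'
  even : K % 2 = 0
  sup : ∀ r, K ≤ r → c r = 0

lemma Viol.Kpos {K τ : ℕ} {a t c : ℕ → ℕ} (h : Viol K τ a t c) : 0 < K := by
  rcases Nat.eq_zero_or_pos K with rfl | h'
  · have := h.bad; simp [Phi] at this
  · exact h'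

lemma Viol.base {K τ : ℕ} {a t c : ℕ → ℕ} (h : Viol K τ a t c) {s r : ℕ} (hr : r < K)
    (e : τ = s * K + (K - 1 - r)) :
    t r ≤ s ∧ s < c r ∧ Phi K c (τ+1) + Phi K a (τ+1) = 2 * Phi K t (τ+1) ∧
    Phi K c τ + Phi K a τ = 2 * Phi K t τ + 1 := by
  have h1 := Phi_step K a s r hr
  have h2 := Phi_step K t s r hr
  have h3 := Phi_step K c s r hr
  rw [← e] at h1 h2 h3
  have h4 := h.bad
  have h5 := h.good (τ+1) (by omega)
  have := (h.i1 r).1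
  have := (h.i2 r).1
  split_ifs at h1 h2 h3 <;> omega

lemma Viol.P {K τ : ℕ} {a t c : ℕ → ℕ} (h : Viol K τ a t c) {r : ℕ} (hr : r + 2 < K)
    (hb : (τ + (r + 2)) / K ≠ (τ + r) / K) (h1 : (τ + r) / K < c (r + 2)) :
    (τ + r) / K < a r := by
  by_contra h2
  push Not at h2
  have hK := h.Kpos
  obtain ⟨s, q, hq, e⟩ := pos_decomp K hK τ
  obtain ⟨b1, b2, b3, b4⟩ := h.base hq e
  have key : ∀ u, u < K → (τ + u) / K = if q < u then s + 1 else s := by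
    intro u hu
    have : (s+1)*K = s*K + K := by ring
    have : (s+1+1)*K = s*K + 2*K := by ring
    split_ifs with h
    · apply Nat.div_eq_of_lt_le <;> omega
    · apply Nat.div_eq_of_lt_le <;> omega
  rw [key _ hr, key _ (by omega)] at hb
  rw [key _ (by omega)] at h1 h2
  have hqr : ¬ q < r := by
    intro hh; rw [if_pos hh, if_pos (by omega)] at hb; omega
  have hqr' : q < r + 2 := by
    by_contra hh; rw [if_neg hqr, if_neg (by omega)] at hb; omega
  rw [if_neg hqr] at h1 h2
  have := (h.i2 r).2
  rcases (by omega : q = r ∨ q = r + 1) with rfl | rfl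
  · omega
  · have e' : τ + 1 = s * K + (K - 1 - r) := by omega
    have h1 := Phi_step K a s r (by omega)
    have h2 := Phi_step K t s r (by omega)
    have h3 := Phi_step K c s r (by omega)
    rw [← e'] at h1 h2 h3
    have h5 := h.good (τ+1+1) (by omega)
    have := (h.i1 r).1
    have := (h.i2 r).1
    split_ifs at h1 h2 h3 <;> omega

lemma Viol.H {K τ : ℕ} {a t c : ℕ → ℕ} (h : Viol K τ a t c) {r : ℕ} (hr : r < K)
    (h1 : (τ + r) / K < t r) : (τ + r) / K ≤ tL a c r := by
  by_contra h2
  push Not at h2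
  have hK := h.Kpos
  obtain ⟨s, q, hq, e⟩ := pos_decomp K hK τ
  obtain ⟨b1, b2, b3, b4⟩ := h.base hq e
  obtain ⟨b, hb⟩ : ∃ b, (τ + r) / K = b := ⟨_, rfl⟩
  rw [hb] at h1 h2
  have hb1 : b * K ≤ τ + r := by rw [← hb]; exact Nat.div_mul_le_self _ _
  have hb2 : τ + r < b * K + K := by
    have := Nat.lt_div_mul_add (a := τ + r) hK; rw [hb] at this; exact this
  have hcb : c (r + 2) < b := lt_of_le_of_lt (le_max_left _ _) h2
  have hab : a r < b := lt_of_le_of_lt (le_max_right _ _) h2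
  obtain ⟨y, hy⟩ : ∃ y, y = b * K + (K - 1 - r) := ⟨_, rfl⟩
  have hty : τ < y := by
    rcases (by omega : τ < y ∨ τ = y) with h' | h'
    · exact h'
    · exfalso
      obtain ⟨d1, -⟩ := h.base hr (h'.trans hy)
      omega
  -- Psi at y is ≥ 1
  have hPy : Phi K c y + Phi K a y + 1 ≤ 2 * Phi K t y := by
    have g1 := Phi_step K a b r hr
    have g2 := Phi_step K t b r hr
    have g3 := Phi_step K c b r hr
    rw [← hy] at g1 g2 g3
    have h5 := h.good (y+1) (by omega)
    have := (h.i2 r).1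
    split_ifs at g1 g2 g3 <;> omega
  -- existence of θ1
  have hex : ∃ θ, τ < θ ∧ θ < y ∧ ∃ s' q', q' < K ∧ θ = s' * K + (K - 1 - q') ∧ t q' ≤ s' ∧ s' < c q' := by
    by_contra hne
    have mono : ∀ z, τ + 1 ≤ z → z ≤ y → 2 * Phi K t z ≤ Phi K c z + Phi K a z := by
      intro z hz
      induction z, hz using Nat.le_induction with
      | base => intro _; omega
      | succ z hz ih =>
        intro hzy
        have ih' := ih (by omega)
        obtain ⟨s', q', hq', e'⟩ := pos_decomp K hK z
        have hno : ¬ (t q' ≤ s' ∧ s' < c q') := fun hh =>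
          hne ⟨z, by omega, by omega, s', q', hq', e', hh.1, hh.2⟩
        have g1 := Phi_step K a s' q' hq'
        have g2 := Phi_step K t s' q' hq'
        have g3 := Phi_step K c s' q' hq'
        rw [← e'] at g1 g2 g3
        have := (h.i1 q').1
        have := (h.i2 q').1
        split_ifs at g1 g2 g3 <;> omega
    have := mono y (by omega) le_rfl
    omega
  obtain ⟨θ, hθ1, hθ2, s', q', hq', e', c1, c2⟩ := hex
  have w0 := win hq hr (b := b) (by rw [← e, ← hy]; exact hty) (by rw [← e, ← hy]; omega)
  have w1 := win hq' hr (b := b) (by rw [← e', ← hy]; exact hθ2) (by rw [← e', ← hy]; omega)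
  have w2 := win hq hq' (by rw [← e, ← e']; exact hθ1) (by rw [← e, ← e']; omega)
  have X : ∀ u v, t v ≤ u → u < c v → ((u = b ∧ r < v) ∨ (u + 1 = b ∧ v < r)) → v % 2 ≠ r % 2 := by
    intro u v k1 k2 k3 k4
    rcases k3 with ⟨rfl, k3⟩ | ⟨k3, k5⟩
    · rcases (by omega : v = r + 2 ∨ r + 2 < v) with rfl | k6
      · omega
      · have := h.i2.lt_le k6 (by omega)
        have := (h.i2 (r+2)).1
        omega
    · have := h.i2.lt_le k5 k4
      have := (h.i2 r).1
      omega
  have X0 := X s q b1 b2 w0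
  have X1 := X s' q' c1 c2 w1
  have par : q % 2 = q' % 2 := by omega
  rcases w2 with ⟨k1, k2⟩ | ⟨k1, k2⟩
  · have := h.i2.lt_le k2 par.symm
    omega
  · have := h.i2.lt_le k2 par
    omega

lemma sum_shift2 (K : ℕ) (f : ℕ → ℕ) (hK : K % 2 = 0) (h0 : 0 < K) :
    ∑ r ∈ range K, f r + f K + f (K+1) = f 0 + f 1 + ∑ r ∈ range K, f (r + 2) := by
  have h1 := Finset.sum_range_succ f K
  have h2 := Finset.sum_range_succ f (K+1)
  have h3 := Finset.sum_range_succ' f (K+1)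
  have h4 := Finset.sum_range_succ' (fun r => f (r+1)) K
  simp only [zero_add] at h3 h4
  simp only [add_assoc, Nat.reduceAdd] at *
  omega

lemma Viol.weight {K τ : ℕ} {a t c : ℕ → ℕ} (h : Viol K τ a t c) :
    ∑ r ∈ range K, t r + ∑ r ∈ range K, tog K τ a c t r + 1 =
      ∑ r ∈ range K, a r + ∑ r ∈ range K, c r := by
  have hK := h.Kpos
  obtain ⟨s, q, hq, e⟩ := pos_decomp K hK τ
  obtain ⟨-, -, -, b4⟩ := h.base hq e
  have dec : ∀ x : ℕ → ℕ, ∑ r ∈ range K, x r = Phi K x τ + ∑ r ∈ range K, min (x r) ((τ + r) / K) := by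
    intro x
    unfold Phi
    rw [← Finset.sum_add_distrib]
    exact Finset.sum_congr rfl fun r _ => by omega
  have hP : Phi K (tog K τ a c t) τ = Phi K t τ := tog_Phi h.i1 h.i2 le_rfl
  rw [dec t, dec a, dec c, dec (tog K τ a c t), hP]
  suffices hs : ∑ r ∈ range K, min (t r) ((τ + r) / K) + ∑ r ∈ range K, min (tog K τ a c t r) ((τ + r) / K)
      = ∑ r ∈ range K, min (a r) ((τ + r) / K) + ∑ r ∈ range K, min (c r) ((τ + r) / K) by omega
  have s1 : ∑ r ∈ range K, min (t r) ((τ + r) / K) + ∑ r ∈ range K, min (tog K τ a c t r) ((τ + r) / K)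
      = ∑ r ∈ range K, min (tL a c r) ((τ + r) / K) + ∑ r ∈ range K, min (tU a c r) ((τ + r) / K) := by
    rw [← Finset.sum_add_distrib, ← Finset.sum_add_distrib]
    apply Finset.sum_congr rfl
    intro r hr
    have := tL_le h.i1 h.i2 r
    have := le_tU h.i1 h.i2 r
    have := h.H (Finset.mem_range.1 hr)
    unfold tog
    split_ifs <;> omega
  rw [s1]
  have u1 := sum_shift2 K (fun r => min (tU a c r) ((τ + r) / K)) h.even hK
  have u2 := sum_shift2 K (fun r => min (c r) ((τ + r) / K)) h.even hK
  have hU : ∀ r, K ≤ r → tU a c r = 0 := by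
    intro r hr
    have := h.sup r hr
    unfold tU; split_ifs <;> simp [this]
  simp only [hU K le_rfl, hU (K+1) (by omega), h.sup K le_rfl, h.sup (K+1) (by omega)] at u1 u2
  have v0 : tU a c 0 = c 0 := by simp [tU]
  have v1 : tU a c 1 = c 1 := by simp [tU]
  have s2 : ∑ r ∈ range K, min (tL a c r) ((τ + r) / K) + ∑ r ∈ range K, min (tU a c (r+2)) ((τ + (r+2)) / K)
     = ∑ r ∈ range K, min (a r) ((τ + r) / K) + ∑ r ∈ range K, min (c (r+2)) ((τ + (r+2)) / K) := by
    rw [← Finset.sum_add_distrib, ← Finset.sum_add_distrib]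
    apply Finset.sum_congr rfl
    intro r hr
    have hr := Finset.mem_range.1 hr
    have eU : tU a c (r + 2) = min (c (r+2)) (a r) := by simp [tU]
    rw [eU]
    unfold tL
    have m1 : (τ + r) / K ≤ (τ + (r+2)) / K := Nat.div_le_div_right (by omega)
    have m2 : (τ + (r+2)) / K ≤ (τ + r) / K + 1 := by
      rw [← Nat.add_div_right _ hK]; apply Nat.div_le_div_right
      have := h.even; omega
    by_cases hr2 : r + 2 < K
    · have := h.P hr2
      omega
    · have := h.sup (r+2) (by omega)
      omega
  rw [v0, v1] at u1
  omega

end SB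
namespace SB
open Finset

/-- total size of the rows below `K` -/
def sz (K : ℕ) (x : ℕ → ℕ) : ℕ := ∑ r ∈ range K, x r

structure Chain (N : ℕ) (m l : ℕ → ℕ) (w : ℕ → ℕ → ℕ) : Prop where
  zero : w 0 = m
  top : ∀ a, N ≤ a → w a = l
  step : ∀ a, a < N → Inter (w a) (w (a + 1))

/-- weight of a chain -/
def wt (K : ℕ) (w : ℕ → ℕ → ℕ) (j : ℕ) : ℕ := sz K (w (j + 1)) - sz K (w j)

def Good (N K : ℕ) (w : ℕ → ℕ → ℕ) : Prop :=
  ∀ τ i, i + 2 ≤ N → Phi K (w (i + 2)) τ + Phi K (w i) τ ≤ 2 * Phi K (w (i + 1)) τ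

lemma Chain.le_succ {N : ℕ} {m l : ℕ → ℕ} {w : ℕ → ℕ → ℕ} (h : Chain N m l w) (a r : ℕ) :
    w a r ≤ w (a + 1) r := by
  rcases Nat.lt_or_ge a N with ha | ha
  · exact (h.step a ha r).1
  · rw [h.top a ha, h.top (a + 1) (by omega)]

lemma Chain.mono {N : ℕ} {m l : ℕ → ℕ} {w : ℕ → ℕ → ℕ} (h : Chain N m l w) (r : ℕ) :
    Monotone fun a => w a r := monotone_nat_of_le_succ fun a => h.le_succ a r

lemma Chain.le_top {N : ℕ} {m l : ℕ → ℕ} {w : ℕ → ℕ → ℕ} (h : Chain N m l w) (a r : ℕ) :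
    w a r ≤ l r := by
  have := h.mono r (le_max_left a N)
  simp only at this
  rwa [h.top _ (le_max_right a N)] at this

lemma Chain.le_bot {N : ℕ} {m l : ℕ → ℕ} {w : ℕ → ℕ → ℕ} (h : Chain N m l w) (a r : ℕ) :
    m r ≤ w a r := by
  have := h.mono r (Nat.zero_le a)
  simp only at this
  rwa [h.zero] at this

lemma Chain.sz_mono {N : ℕ} {m l : ℕ → ℕ} {w : ℕ → ℕ → ℕ} (h : Chain N m l w) (K : ℕ) :
    Monotone fun a => sz K (w a) := fun _ _ hab =>
  Finset.sum_le_sum fun r _ => h.mono r hab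

lemma Phi_zero (K : ℕ) (x : ℕ → ℕ) : Phi K x 0 = sz K x := by
  apply Finset.sum_congr rfl
  intro r hr
  rw [zero_add, Nat.div_eq_of_lt (Finset.mem_range.1 hr)]; rfl

lemma Phi_large (K : ℕ) (x l : ℕ → ℕ) (h : ∀ r, x r ≤ l r) (τ : ℕ) (hτ : K * sz K l ≤ τ) :
    Phi K x τ = 0 := by
  apply Finset.sum_eq_zero
  intro r hr
  have h1 : l r ≤ sz K l := Finset.single_le_sum (f := l) (fun _ _ => Nat.zero_le _) hr
  have hK : 0 < K := by have := Finset.mem_range.1 hr; omega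
  have h2 : sz K l ≤ (τ + r) / K := by
    rw [Nat.le_div_iff_mul_le hK]; nlinarith
  have := h r
  omega

def violAt (K : ℕ) (w : ℕ → ℕ → ℕ) (τ i : ℕ) : Prop :=
  2 * Phi K (w (i + 1)) τ < Phi K (w (i + 2)) τ + Phi K (w i) τ

structure First (N K : ℕ) (w : ℕ → ℕ → ℕ) (τ i : ℕ) : Prop where
  le : i + 2 ≤ N
  viol : violAt K w τ i
  ab : ∀ τ' i', τ < τ' → i' + 2 ≤ N → ¬ violAt K w τ' i'
  lt : ∀ i', i' < i → ¬ violAt K w τ i'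

lemma First.unique {N K : ℕ} {w : ℕ → ℕ → ℕ} {τ i τ' i' : ℕ} (h : First N K w τ i)
    (h' : First N K w τ' i') : τ = τ' ∧ i = i' := by
  have : τ = τ' := by
    rcases lt_trichotomy τ τ' with hh | hh | hh
    · exact absurd h'.viol (h.ab _ _ hh h'.le)
    · exact hh
    · exact absurd h.viol (h'.ab _ _ hh h.le)
  subst this
  refine ⟨rfl, ?_⟩
  rcases lt_trichotomy i i' with hh | hh | hh
  · exact absurd h.viol (h'.lt _ hh)
  · exact hh
  · exact absurd h'.viol (h.lt _ hh)

lemma exists_first {N K : ℕ} {m l : ℕ → ℕ} {w : ℕ → ℕ → ℕ} (h : Chain N m l w)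
    (hb : ¬ Good N K w) : ∃ p : ℕ × ℕ, First N K w p.1 p.2 := by
  classical
  unfold Good at hb
  push Not at hb
  obtain ⟨τ, i, hi, hv⟩ := hb
  let P : ℕ → Prop := fun τ => ∃ i, i + 2 ≤ N ∧ violAt K w τ i
  have hbd : ∀ τ, P τ → τ ≤ K * sz K l := by
    rintro τ ⟨i, hi, hv⟩
    by_contra hh
    unfold violAt at hv
    rw [Phi_large K (w (i+2)) l (h.le_top _) τ (by omega), Phi_large K (w i) l (h.le_top _) τ (by omega)] at hv
    omega
  have hP : P τ := ⟨i, hi, hv⟩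
  have hP2 := Nat.findGreatest_spec (P := P) (hbd τ hP) hP
  have hmax : ∀ τ', Nat.findGreatest P (K * sz K l) < τ' → ¬ P τ' := by
    intro τ' h1 h2
    exact Nat.findGreatest_is_greatest h1 (hbd _ h2) h2
  obtain ⟨τ0, hτ0⟩ : ∃ τ0, τ0 = Nat.findGreatest P (K * sz K l) := ⟨_, rfl⟩
  rw [← hτ0] at hP2 hmax
  refine ⟨(τ0, Nat.find hP2), ?_, ?_, ?_, ?_⟩
  · exact (Nat.find_spec hP2).1
  · exact (Nat.find_spec hP2).2
  · intro τ' i' h1 h2 h3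
    exact hmax τ' h1 ⟨i', h2, h3⟩
  · intro i' h1 h2
    have := (Nat.find_spec hP2).1
    exact Nat.find_min hP2 h1 ⟨by simp only at h1; omega, h2⟩

lemma First.not_good {N K : ℕ} {w : ℕ → ℕ → ℕ} {τ i : ℕ} (h : First N K w τ i) : ¬ Good N K w :=
  fun hg => by have := hg τ i h.le; have := h.viol; unfold violAt at this; omega

def flip (K : ℕ) (w : ℕ → ℕ → ℕ) (τ i : ℕ) : ℕ → ℕ → ℕ :=
  Function.update w (i + 1) (tog K τ (w i) (w (i + 2)) (w (i + 1)))

section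
variable {N K : ℕ} {m l : ℕ → ℕ} {w : ℕ → ℕ → ℕ} {τ i : ℕ}

lemma First.toViol (h : First N K w τ i) (hw : Chain N m l w) (hK : K % 2 = 0)
    (hl : ∀ r, K ≤ r → l r = 0) : Viol K τ (w i) (w (i + 1)) (w (i + 2)) where
  i1 := hw.step i (by have := h.le; omega)
  i2 := hw.step (i + 1) (by have := h.le; omega)
  bad := h.viol
  good := fun τ' hτ => by
    have := h.ab τ' i hτ h.le
    unfold violAt at this; omega
  even := hK
  sup := fun r hr => by have := hw.le_top (i+2) r; have := hl r hr; omega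

lemma flip_ne (a : ℕ) (h : a ≠ i + 1) : flip K w τ i a = w a := by
  unfold flip; rw [Function.update_of_ne h]

lemma flip_eq : flip K w τ i (i+1) = tog K τ (w i) (w (i + 2)) (w (i + 1)) := by
  unfold flip; rw [Function.update_self]

lemma First.flip_chain (h : First N K w τ i) (hw : Chain N m l w) (hK : K % 2 = 0)
    (hl : ∀ r, K ≤ r → l r = 0) : Chain N m l (flip K w τ i) := by
  have hv := h.toViol hw hK hl
  have hi := h.le
  refine ⟨?_, ?_, ?_⟩
  · rw [flip_ne _ (by omega)]; exact hw.zero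
  · intro a ha; rw [flip_ne _ (by omega)]; exact hw.top a ha
  · intro a ha
    by_cases h1 : a = i
    · subst h1
      rw [flip_ne _ (by omega), flip_eq]; exact (tog_inter hv.i1 hv.i2).1
    · by_cases h2 : a = i + 1
      · subst h2
        rw [flip_ne (i+1+1) (by omega), flip_eq]; exact (tog_inter hv.i1 hv.i2).2
      · rw [flip_ne _ (by omega), flip_ne _ (by omega)]; exact hw.step a ha

lemma First.flip_Phi (h : First N K w τ i) (hw : Chain N m l w) (hK : K % 2 = 0)
    (hl : ∀ r, K ≤ r → l r = 0) (a τ' : ℕ) (hτ : τ ≤ τ') :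
    Phi K (flip K w τ i a) τ' = Phi K (w a) τ' := by
  have hv := h.toViol hw hK hl
  by_cases ha : a = i + 1
  · subst ha; rw [flip_eq]; exact tog_Phi hv.i1 hv.i2 hτ
  · rw [flip_ne _ ha]

lemma First.flip_first (h : First N K w τ i) (hw : Chain N m l w) (hK : K % 2 = 0)
    (hl : ∀ r, K ≤ r → l r = 0) : First N K (flip K w τ i) τ i := by
  have key : ∀ τ' i', τ ≤ τ' → (violAt K (flip K w τ i) τ' i' ↔ violAt K w τ' i') := by
    intro τ' i' hh
    unfold violAt
    rw [h.flip_Phi hw hK hl _ _ hh, h.flip_Phi hw hK hl _ _ hh, h.flip_Phi hw hK hl _ _ hh]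
  refine ⟨h.le, (key _ _ le_rfl).2 h.viol, ?_, ?_⟩
  · intro τ' i' h1 h2 h3; exact h.ab τ' i' h1 h2 ((key _ _ h1.le).1 h3)
  · intro i' h1 h3; exact h.lt i' h1 ((key _ _ le_rfl).1 h3)

lemma First.flip_flip (h : First N K w τ i) (hw : Chain N m l w) (hK : K % 2 = 0)
    (hl : ∀ r, K ≤ r → l r = 0) : flip K (flip K w τ i) τ i = w := by
  have hv := h.toViol hw hK hl
  funext a
  by_cases ha : a = i + 1
  · subst ha; rw [flip_eq, flip_eq, flip_ne i (by omega), flip_ne (i+2) (by omega), tog_tog hv.i1 hv.i2]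
  · rw [flip_ne _ ha, flip_ne _ ha]

end

noncomputable def alt (N : ℕ) (β : ℕ → ℕ) : MvPolynomial (Fin N) ℤ :=
  Matrix.det (Matrix.of fun i j : Fin N => (MvPolynomial.X i : MvPolynomial (Fin N) ℤ) ^ β j)

def dl (N : ℕ) (j : ℕ) : ℕ := N - 1 - j

lemma alt_swap (N : ℕ) (β β' : ℕ → ℕ) (i : ℕ) (hi : i + 2 ≤ N)
    (h1 : β' i = β (i+1)) (h2 : β' (i+1) = β i) (h3 : ∀ j, j ≠ i → j ≠ i + 1 → β' j = β j) :
    alt N β + alt N β' = 0 := by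
  let p : Fin N := ⟨i, by omega⟩
  let q : Fin N := ⟨i+1, by omega⟩
  have hpq : p ≠ q := by simp [p, q]
  have : alt N β' = Matrix.det ((Matrix.of fun i j : Fin N => (MvPolynomial.X i : MvPolynomial (Fin N) ℤ) ^ β j).submatrix id (Equiv.swap p q)) := by
    unfold alt
    congr 1
    ext1 a b
    simp only [Matrix.of_apply, Matrix.submatrix_apply, id]
    congr 1
    by_cases hb : b = p
    · subst hb; rw [Equiv.swap_apply_left]; exact h1
    · by_cases hb' : b = q
      · subst hb'; rw [Equiv.swap_apply_right]; exact h2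
      · rw [Equiv.swap_apply_of_ne_of_ne hb hb']
        exact h3 b (fun e => hb (Fin.ext e)) (fun e => hb' (Fin.ext e))
  rw [this, Matrix.det_permute', Equiv.Perm.sign_swap hpq]
  simp [alt]

lemma First.alt_flip {N K : ℕ} {m l : ℕ → ℕ} {w : ℕ → ℕ → ℕ} {τ i : ℕ}
    (h : First N K w τ i) (hw : Chain N m l w) (hK : K % 2 = 0)
    (hl : ∀ r, K ≤ r → l r = 0) :
    alt N (fun j => dl N j + wt K w j) + alt N (fun j => dl N j + wt K (flip K w τ i) j) = 0 := by
  have hv := h.toViol hw hK hl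
  have hwt := hv.weight
  have hi := h.le
  have f1 : sz K (w i) ≤ sz K (w (i+1)) := hw.sz_mono K (by omega : i ≤ i + 1)
  have f2 : sz K (w (i+1)) ≤ sz K (w (i+2)) := hw.sz_mono K (by omega : i + 1 ≤ i + 2)
  have hwt' : sz K (w (i+1)) + sz K (tog K τ (w i) (w (i + 2)) (w (i + 1))) + 1
    = sz K (w i) + sz K (w (i+2)) := hwt
  have e1 := flip_eq (K := K) (w := w) (τ := τ) (i := i)
  have e0 := flip_ne (K := K) (w := w) (τ := τ) (i := i) i (by omega)
  have e2 := flip_ne (K := K) (w := w) (τ := τ) (i := i) (i+2) (by omega)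
  have hw' := h.flip_chain hw hK hl
  have g1 : sz K (flip K w τ i i) ≤ sz K (flip K w τ i (i+1)) := hw'.sz_mono K (by omega : i ≤ i + 1)
  have g2 : sz K (flip K w τ i (i+1)) ≤ sz K (flip K w τ i (i+2)) := hw'.sz_mono K (by omega : i + 1 ≤ i + 2)
  rw [e0, e1] at g1
  rw [e1, e2] at g2
  apply alt_swap N _ _ i hi
  · simp only [wt, dl]
    rw [show i + 1 + 1 = i + 2 by ring, e0, e1]
    omega
  · simp only [wt, dl]
    rw [show i + 1 + 1 = i + 2 by ring, e2, e1]
    omega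
  · intro j h1 h2
    simp only [wt]
    rw [flip_ne j h2, flip_ne (j+1) (by omega)]

open Classical in
lemma sum_good {N K : ℕ} {m l : ℕ → ℕ} (hK : K % 2 = 0) (hl : ∀ r, K ≤ r → l r = 0)
    (S : Finset (ℕ → ℕ → ℕ)) (hS : ∀ w, w ∈ S ↔ Chain N m l w) :
    ∑ w ∈ S, alt N (fun j => dl N j + wt K w j) =
      ∑ w ∈ S with Good N K w, alt N (fun j => dl N j + wt K w j) := by
  rw [← Finset.sum_filter_add_sum_filter_not S (Good N K)]
  rw [add_eq_left]
  let g : ∀ w ∈ S.filter (fun w => ¬ Good N K w), (ℕ → ℕ → ℕ) := fun w hw =>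
    flip K w (exists_first ((hS w).1 (mem_filter.1 hw).1) (mem_filter.1 hw).2).choose.1
      (exists_first ((hS w).1 (mem_filter.1 hw).1) (mem_filter.1 hw).2).choose.2
  have key : ∀ w (hw : w ∈ S.filter (fun w => ¬ Good N K w)),
      ∃ τ i, First N K w τ i ∧ g w hw = flip K w τ i := fun w hw =>
    ⟨_, _, (exists_first ((hS w).1 (mem_filter.1 hw).1) (mem_filter.1 hw).2).choose_spec, rfl⟩
  have gm : ∀ w hw, g w hw ∈ S.filter (fun w => ¬ Good N K w) := by
    intro w hw
    obtain ⟨τ, i, h1, h2⟩ := key w hw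
    have hc := (hS w).1 (mem_filter.1 hw).1
    rw [h2, mem_filter, hS]
    exact ⟨h1.flip_chain hc hK hl, (h1.flip_first hc hK hl).not_good⟩
  have hz : ∀ w hw, alt N (fun j => dl N j + wt K w j) + alt N (fun j => dl N j + wt K (g w hw) j) = 0 := by
    intro w hw
    obtain ⟨τ, i, h1, h2⟩ := key w hw
    have hc := (hS w).1 (mem_filter.1 hw).1
    rw [h2]; exact h1.alt_flip hc hK hl
  refine Finset.sum_involution g hz ?_ gm ?_
  · intro w hw h1 h2
    have := hz w hw
    rw [h2] at this
    exact h1 (self_eq_neg.1 (eq_neg_of_add_eq_zero_left this))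
  · intro w hw
    obtain ⟨τ, i, h1, h2⟩ := key w hw
    obtain ⟨τ', i', h1', h2'⟩ := key (g w hw) (gm w hw)
    have hc := (hS w).1 (mem_filter.1 hw).1
    have hf := h1.flip_first hc hK hl
    rw [← h2] at hf
    obtain ⟨rfl, rfl⟩ := hf.unique h1'
    rw [h2', h2, h1.flip_flip hc hK hl]

lemma alt_mul {N : ℕ} (β : ℕ → ℕ) {ι : Type*} (S : Finset ι) (γ : ι → ℕ → ℕ)
    (f : MvPolynomial (Fin N) ℤ) (hf : f = ∑ w ∈ S, ∏ i : Fin N, MvPolynomial.X i ^ γ w i)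
    (hs : ∀ σ : Equiv.Perm (Fin N), MvPolynomial.rename σ f = f) :
    alt N β * f = ∑ w ∈ S, alt N (fun j => β j + γ w j) := by
  unfold alt
  simp only [Matrix.det_apply]
  rw [Finset.sum_comm, Finset.sum_mul]
  apply Finset.sum_congr rfl
  intro σ _
  rw [smul_mul_assoc, ← Finset.smul_sum]
  congr 1
  conv_lhs => rw [← hs σ]
  rw [hf, map_sum, Finset.mul_sum]
  apply Finset.sum_congr rfl
  intro w _
  rw [map_prod, ← Finset.prod_mul_distrib]
  apply Finset.prod_congr rfl
  intro i _
  simp [pow_add]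

lemma alt_dl_ne_zero (N : ℕ) : alt N (dl N) ≠ 0 := by
  have : alt N (dl N) = Matrix.det ((Matrix.vandermonde (fun i : Fin N => (MvPolynomial.X i : MvPolynomial (Fin N) ℤ))).submatrix id (Fin.revPerm)) := by
    unfold alt
    congr 1
    ext1 a b
    simp only [Matrix.of_apply, Matrix.submatrix_apply, id, Matrix.vandermonde_apply, Fin.revPerm_apply, Fin.val_rev, dl]
    congr 1
    omega
  rw [this, Matrix.det_permute']
  refine mul_ne_zero ?_ ?_
  · rcases Int.units_eq_one_or (Equiv.Perm.sign (Fin.revPerm : Equiv.Perm (Fin N))) with h | h <;> simp [h]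
  · rw [Matrix.det_vandermonde_ne_zero_iff]
    exact MvPolynomial.X_injective

lemma Good.antitone {N K : ℕ} {m l : ℕ → ℕ} {w : ℕ → ℕ → ℕ} (hw : Chain N m l w) (h : Good N K w) :
    Antitone (wt K w) ∧ ∀ j, N ≤ j → wt K w j = 0 := by
  have hz : ∀ j, N ≤ j → wt K w j = 0 := by
    intro j hj
    simp [wt, hw.top j hj, hw.top (j+1) (by omega)]
  refine ⟨antitone_nat_of_succ_le fun j => ?_, hz⟩
  rcases Nat.lt_or_ge (j+1) N with h1 | h1
  · have := h 0 j (by omega)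
    simp only [Phi_zero] at this
    have f1 : sz K (w j) ≤ sz K (w (j+1)) := hw.sz_mono K (by omega : j ≤ j + 1)
    have f2 : sz K (w (j+1)) ≤ sz K (w (j+2)) := hw.sz_mono K (by omega : j + 1 ≤ j + 2)
    simp only [wt, show j + 1 + 1 = j + 2 by ring]
    omega
  · rw [hz _ h1]; exact Nat.zero_le _

end SB
namespace SB
open Finset

/-! ### complete homogeneous polynomials in the first variables -/

noncomputable def Hs {N : ℕ} (s : Finset (Fin N)) (z : ℕ) : MvPolynomial (Fin N) ℤ :=
  ∑ t ∈ s.sym z, (t.1.map MvPolynomial.X).prod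

lemma Hs_insert {N : ℕ} (s : Finset (Fin N)) (a : Fin N) (ha : a ∉ s) (z : ℕ) :
    Hs (insert a s) z = ∑ i ∈ range (z + 1), MvPolynomial.X a ^ i * Hs s (z - i) := by
  unfold Hs
  rw [← Finset.sum_coe_sort, ← (Finset.symInsertEquiv ha).symm.sum_comp, Fintype.sum_sigma,
    Finset.sum_range]
  apply Finset.sum_congr rfl
  intro i _
  rw [Finset.mul_sum, ← Finset.sum_coe_sort (s.sym (z - i))]
  apply Finset.sum_congr rfl
  intro t _
  have : ((((Finset.symInsertEquiv ha).symm ⟨i, t⟩ : (insert a s).sym z) : Sym (Fin N) z) : Multiset (Fin N))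
      = (t : Sym (Fin N) (z - i)) + Multiset.replicate i a := rfl
  simp only [Sym.val_eq_coe]
  rw [this]
  simp [mul_comm]

lemma Hs_insert_succ {N : ℕ} (s : Finset (Fin N)) (a : Fin N) (ha : a ∉ s) (z : ℕ) :
    Hs (insert a s) (z + 1) = Hs s (z + 1) + MvPolynomial.X a * Hs (insert a s) z := by
  rw [Hs_insert s a ha, Hs_insert s a ha, Finset.sum_range_succ', Finset.mul_sum, add_comm]
  simp only [pow_zero, one_mul, Nat.sub_zero, pow_succ']
  congr 1
  apply Finset.sum_congr rfl
  intro i _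
  rw [show z + 1 - (i + 1) = z - i by omega, mul_assoc]

lemma Hs_zero {N : ℕ} (s : Finset (Fin N)) : Hs s 0 = 1 := by
  simp [Hs, Finset.sym_zero]
  rfl

noncomputable def hh (N n : ℕ) (z : ℤ) : MvPolynomial (Fin N) ℤ :=
  if 0 ≤ z then Hs (univ.filter fun i : Fin N => (i : ℕ) < n) z.toNat else 0

noncomputable def xx (N a : ℕ) : MvPolynomial (Fin N) ℤ :=
  if h : a < N then MvPolynomial.X ⟨a, h⟩ else 0

lemma hh_neg (N n : ℕ) (z : ℤ) (hz : z < 0) : hh N n z = 0 := by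
  unfold hh; rw [if_neg (by omega)]

lemma hh_zero (N : ℕ) (z : ℤ) : hh N 0 z = if z = 0 then 1 else 0 := by
  unfold hh
  simp only [Nat.not_lt_zero, Finset.filter_false]
  rcases lt_trichotomy z 0 with h | h | h
  · rw [if_neg (by omega), if_neg (by omega)]
  · subst h; simp [Hs_zero]
  · rw [if_pos h.le, if_neg (by omega)]
    obtain ⟨n, rfl⟩ : ∃ n : ℕ, z = n + 1 := ⟨(z - 1).toNat, by omega⟩
    rw [show ((n : ℤ) + 1).toNat = n + 1 by omega]
    simp [Hs, Finset.sym_empty]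

lemma hh_succ (N n : ℕ) (hn : n < N) (z : ℤ) :
    hh N (n + 1) z = hh N n z + xx N n * hh N (n + 1) (z - 1) := by
  have hi : (univ.filter fun i : Fin N => (i : ℕ) < n + 1) =
      insert ⟨n, hn⟩ (univ.filter fun i : Fin N => (i : ℕ) < n) := by
    ext i; simp [Fin.ext_iff]; omega
  unfold hh xx
  rw [dif_pos hn, hi]
  rcases lt_trichotomy z 0 with h | h | h
  · rw [if_neg (by omega), if_neg (by omega), if_neg (by omega)]; simp
  · subst h; simp [Hs_zero]
  · obtain ⟨m, rfl⟩ : ∃ m : ℕ, z = m + 1 := ⟨(z - 1).toNat, by omega⟩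
    rw [if_pos h.le, if_pos h.le, if_pos (by omega), show ((m : ℤ) + 1).toNat = m + 1 by omega,
      show ((m : ℤ) + 1 - 1).toNat = m by omega]
    exact Hs_insert_succ _ _ (by simp) _

lemma hh_top (N : ℕ) (z : ℤ) : hh N N z = homog N z := by
  unfold hh homog
  split_ifs
  · unfold Hs MvPolynomial.hsymm
    have : (univ.filter fun i : Fin N => (i : ℕ) < N) = univ := by simp
    rw [this, Finset.sym_univ]
  · rfl

lemma hh_iter (N n : ℕ) (hn : n < N) (z : ℤ) (D : ℕ) :
    hh N (n + 1) z = ∑ i ∈ range D, xx N n ^ i * hh N n (z - i) + xx N n ^ D * hh N (n + 1) (z - D) := by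
  induction D with
  | zero => simp
  | succ D ih =>
    rw [ih, Finset.sum_range_succ, hh_succ N n hn (z - D), pow_succ]
    push_cast
    rw [show z - ((D:ℤ) + 1) = z - D - 1 by ring]
    ring

/-! ### finset of chains -/
def extF (K : ℕ) (f : Fin K → ℕ) (r : ℕ) : ℕ := if h : r < K then f ⟨r, h⟩ else 0

lemma extF_inj (K : ℕ) : Function.Injective (extF K) := by
  intro f g h
  funext r
  have := congrFun h r
  simpa [extF] using this

def interF (K : ℕ) (l : ℕ → ℕ) : Finset (ℕ → ℕ) :=
  (Fintype.piFinset fun r : Fin K => Icc (l (r + 2)) (l r)).map ⟨extF K, extF_inj K⟩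

def A2 (x : ℕ → ℕ) : Prop := ∀ r, x (r + 2) ≤ x r

lemma A2.le {x : ℕ → ℕ} (h : A2 x) {p q : ℕ} (hpq : p ≤ q) (hm : p % 2 = q % 2) : x q ≤ x p := by
  obtain ⟨j, rfl⟩ : ∃ j, q = p + 2 * j := ⟨(q - p) / 2, by omega⟩
  clear hpq hm
  induction j with
  | zero => exact le_rfl
  | succ j ih => exact (h (p + 2 * j)).trans ih

lemma mem_interF {K : ℕ} {l : ℕ → ℕ} (hl : ∀ r, K ≤ r → l r = 0) (y : ℕ → ℕ) :
    y ∈ interF K l ↔ Inter y l := by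
  unfold interF
  simp only [Finset.mem_map, Fintype.mem_piFinset, Finset.mem_Icc, Function.Embedding.coeFn_mk]
  constructor
  · rintro ⟨f, hf, rfl⟩ r
    unfold extF
    split_ifs with h
    · exact ⟨(hf ⟨r, h⟩).2, (hf ⟨r, h⟩).1⟩
    · rw [hl r (by omega), hl (r+2) (by omega)]; simp
  · intro h
    refine ⟨fun r => y r, fun r => ⟨(h r).2, (h r).1⟩, ?_⟩
    funext r
    unfold extF
    split_ifs with h1
    · rfl
    · have := (h r).1; rw [hl r (by omega)] at this; omega

open Classical in
noncomputable def chains (K : ℕ) (m : ℕ → ℕ) : ℕ → (ℕ → ℕ) → Finset (ℕ → ℕ → ℕ)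
  | 0, l => if m = l then {fun _ => l} else ∅
  | N + 1, l => (interF K l).biUnion fun y =>
      (chains K m N y).image (fun w a => if a ≤ N then w a else l)

lemma Inter.sup {K : ℕ} {y l : ℕ → ℕ} (h : Inter y l) (hl : ∀ r, K ≤ r → l r = 0) :
    ∀ r, K ≤ r → y r = 0 := fun r hr => by have := (h r).1; have := hl r hr; omega

lemma Inter.A2 {y l : ℕ → ℕ} (h : Inter y l) : A2 y := fun r =>
  ((h (r+2)).1).trans (h r).2

lemma mem_chains {K : ℕ} {m : ℕ → ℕ} (N : ℕ) : ∀ {l : ℕ → ℕ} (_ : ∀ r, K ≤ r → l r = 0) (w : ℕ → ℕ → ℕ),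
    w ∈ chains K m N l ↔ Chain N m l w := by
  induction N with
  | zero =>
    intro l hl w
    unfold chains
    split_ifs with h
    · subst h
      rw [Finset.mem_singleton]
      constructor
      · rintro rfl; exact ⟨rfl, fun _ _ => rfl, fun a ha => by omega⟩
      · intro hw; funext a; exact hw.top a (by omega)
    · simp only [Finset.notMem_empty, false_iff]
      intro hw
      exact h (hw.zero.symm.trans (hw.top 0 le_rfl))
  | succ N ih =>
    intro l hl w
    unfold chains
    simp only [Finset.mem_biUnion, Finset.mem_image]
    constructor
    · rintro ⟨y, hy, w, hw, rfl⟩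
      rw [mem_interF hl] at hy
      rw [ih (hy.sup hl)] at hw
      refine ⟨by simpa using hw.zero, fun a ha => by rw [if_neg (by omega)], fun a ha => ?_⟩
      rw [if_pos (by omega)]
      split_ifs with h
      · exact hw.step a (by omega)
      · rw [hw.top a (by omega)]; exact hy
    · intro hw
      have hi : Inter (w N) l := by
        have := hw.step N (by omega); rwa [hw.top (N+1) le_rfl] at this
      refine ⟨w N, (mem_interF hl _).2 hi, fun a => w (min a N), ?_, ?_⟩
      · rw [ih (hi.sup hl)]
        refine ⟨by simpa using hw.zero, fun a ha => by rw [min_eq_right ha], fun a ha => ?_⟩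
        rw [min_eq_left (by omega), min_eq_left (by omega)]
        exact hw.step a (by omega)
      · funext a
        split_ifs with h
        · show w (min a N) = w a
          rw [min_eq_left h]
        · rw [hw.top a (by omega)]

lemma sum_chains_succ {K : ℕ} {m : ℕ → ℕ} (N : ℕ) {l : ℕ → ℕ} (hl : ∀ r, K ≤ r → l r = 0)
    {M : Type*} [AddCommMonoid M] (F : (ℕ → ℕ → ℕ) → M) :
    ∑ w ∈ chains K m (N + 1) l, F w = ∑ y ∈ interF K l, ∑ w ∈ chains K m N y,
      F (fun a => if a ≤ N then w a else l) := by
  classical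
  conv_lhs => unfold chains
  rw [Finset.sum_biUnion]
  · apply Finset.sum_congr rfl
    intro y hy
    rw [mem_interF hl] at hy
    rw [Finset.sum_image]
    intro w hw w' hw' h
    have hw := (mem_chains N (hy.sup hl) w).1 hw
    have hw' := (mem_chains N (hy.sup hl) w').1 hw'
    funext a
    rcases Nat.le_total a N with ha | ha
    · have := congrFun h a
      simpa [ha] using this
    · rw [hw.top a ha, hw'.top a ha]
  · intro y hy y' hy' hne
    rw [Function.onFun, Finset.disjoint_left]
    intro v hv hv'
    simp only [Finset.mem_image] at hv hv'
    obtain ⟨w, hw, rfl⟩ := hv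
    obtain ⟨w', hw', h⟩ := hv'
    have hy := (mem_interF hl _).1 hy
    have hy' := (mem_interF hl _).1 hy'
    have hw := (mem_chains N (hy.sup hl) w).1 hw
    have hw' := (mem_chains N (hy'.sup hl) w').1 hw'
    have := congrFun h N
    simp only [le_refl, if_true] at this
    rw [hw.top N le_rfl, hw'.top N le_rfl] at this
    exact hne this.symm

/-! ### Jacobi–Trudi -/

noncomputable def jrow (N K n : ℕ) (m : ℕ → ℕ) (p y : ℕ) (q : Fin K) : MvPolynomial (Fin N) ℤ :=
  if p % 2 = (q : ℕ) % 2 then hh N n ((y : ℤ) - m q - (p / 2 : ℕ) + ((q : ℕ) / 2 : ℕ)) else 0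

noncomputable def jmat (N K n : ℕ) (m l : ℕ → ℕ) : Matrix (Fin K) (Fin K) (MvPolynomial (Fin N) ℤ) :=
  Matrix.of fun p q => jrow N K n m p (l p) q

open Classical in
lemma jmat_zero (N K : ℕ) (m l : ℕ → ℕ) (hm : A2 m) (hl : A2 l) (hm0 : ∀ r, K ≤ r → m r = 0)
    (hl0 : ∀ r, K ≤ r → l r = 0) : (jmat N K 0 m l).det = if m = l then 1 else 0 := by
  split_ifs with h
  · subst h
    have : jmat N K 0 m m = 1 := by
      ext1 p q
      simp only [jmat, jrow, Matrix.of_apply, hh_zero]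
      by_cases hpq : p = q
      · subst hpq; simp
      · rw [Matrix.one_apply_ne hpq]
        have hpq' : (p : ℕ) ≠ q := fun e => hpq (Fin.ext e)
        split_ifs with h1 h2
        · exfalso
          rcases Nat.lt_or_ge (p : ℕ) q with h3 | h3
          · have := hm.le h3.le h1; omega
          · have := hm.le h3 h1.symm; omega
        · rfl
        · rfl
    rw [this, Matrix.det_one]
  · have hex : ∃ r, m r ≠ l r := by
      by_contra hh; push Not at hh; exact h (funext hh)
    obtain ⟨ρ, hρ⟩ : ∃ ρ, ρ = Nat.find hex := ⟨_, rfl⟩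
    have h1 : m ρ ≠ l ρ := by rw [hρ]; exact Nat.find_spec hex
    have h2 : ∀ q, q < ρ → m q = l q := by
      intro q hq; rw [hρ] at hq; have := Nat.find_min hex hq; simpa using this
    have hK : ρ < K := by
      by_contra hh; rw [hm0 ρ (by omega), hl0 ρ (by omega)] at h1; exact h1 rfl
    rcases Nat.lt_or_ge (m ρ) (l ρ) with h3 | h3
    · apply Matrix.det_eq_zero_of_row_eq_zero ⟨ρ, hK⟩
      intro q
      simp only [jmat, jrow, Matrix.of_apply, hh_zero]
      split_ifs with e1 e2
      · exfalso
        rcases Nat.lt_or_ge (q : ℕ) ρ with h4 | h4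
        · have := hl.le h4.le e1.symm; have := h2 _ h4; omega
        · have := hm.le h4 e1; omega
      · rfl
      · rfl
    · apply Matrix.det_eq_zero_of_column_eq_zero ⟨ρ, hK⟩
      intro q
      simp only [jmat, jrow, Matrix.of_apply, hh_zero]
      split_ifs with e1 e2
      · exfalso
        rcases Nat.lt_or_ge (q : ℕ) ρ with h4 | h4
        · have := hm.le h4.le e1; have := h2 _ h4; omega
        · have := hl.le h4 e1.symm; omega
      · rfl
      · rfl

lemma jrow_rec (N K n : ℕ) (hn : n < N) (hK : K % 2 = 0) (m l : ℕ → ℕ) (hl : A2 l)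
    (hl0 : ∀ r, K ≤ r → l r = 0) (p : ℕ) (hp : p < K) (q : Fin K) :
    jrow N K (n + 1) m p (l p) q =
      ∑ y ∈ Icc (l (p + 2)) (l p), xx N n ^ (l p - y) * jrow N K n m p y q
      + xx N n ^ (l p - l (p + 2) + 1) *
        (if p + 2 < K then jrow N K (n + 1) m (p + 2) (l (p + 2)) q else 0) := by
  unfold jrow
  by_cases hpar : p % 2 = (q : ℕ) % 2
  · simp only [if_pos hpar, Nat.add_mod_right]
    have hle := hl p
    rw [hh_iter N n hn _ (l p - l (p + 2) + 1)]
    congr 1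
    · refine Finset.sum_bij' (fun i _ => l p - i) (fun y _ => l p - y) ?_ ?_ ?_ ?_ ?_
      · intro i hi; rw [Finset.mem_range] at hi; rw [Finset.mem_Icc]; omega
      · intro i hi; rw [Finset.mem_Icc] at hi; rw [Finset.mem_range]; omega
      · intro i hi; rw [Finset.mem_range] at hi; omega
      · intro i hi; rw [Finset.mem_Icc] at hi; omega
      · intro i hi; rw [Finset.mem_range] at hi
        rw [show l p - (l p - i) = i by omega]
        congr 2
        push_cast [Nat.cast_sub (by omega : i ≤ l p)]
        ring
    · congr 1
      split_ifs with h
      · congr 1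
        rw [Nat.add_div_right _ (by norm_num)]
        push_cast [Nat.cast_sub hle]
        ring
      · apply hh_neg
        have := hl0 (p + 2) (by omega)
        have := q.2
        push_cast [Nat.cast_sub hle]
        omega
  · simp [if_neg hpar]

lemma jmat_succ (N K n : ℕ) (hn : n < N) (hK : K % 2 = 0) (m l : ℕ → ℕ) (hl : A2 l)
    (hl0 : ∀ r, K ≤ r → l r = 0) :
    (jmat N K (n + 1) m l).det =
      ∑ y ∈ interF K l, xx N n ^ (sz K l - sz K y) * (jmat N K n m y).det := by
  classical
  let C : Matrix (Fin K) (Fin K) (MvPolynomial (Fin N) ℤ) := Matrix.of fun p q =>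
    if q = p then 1 else if (q : ℕ) = p + 2 then - xx N n ^ (l p - l (p + 2) + 1) else 0
  have hC : C.det = 1 := by
    rw [Matrix.det_of_isUpperTriangular]
    · simp [C]
    · intro i j hij
      simp only [id] at hij
      have : (j : ℕ) < i := hij
      simp only [C, Matrix.of_apply]
      rw [if_neg (by intro e; subst e; omega), if_neg (by omega)]
  have hCR : C * jmat N K (n + 1) m l = Matrix.of fun p : Fin K =>
      ∑ y ∈ Icc (l (p + 2)) (l p), xx N n ^ (l p - y) • jrow N K n m p y := by
    ext1 p q
    rw [Matrix.mul_apply]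
    simp only [Matrix.of_apply, Finset.sum_apply, Pi.smul_apply, smul_eq_mul]
    have e := jrow_rec N K n hn hK m l hl hl0 p p.2 q
    have hsum : ∑ j, C p j * jmat N K (n + 1) m l j q = jrow N K (n + 1) m p (l p) q
      - xx N n ^ (l p - l (p + 2) + 1) *
        (if (p : ℕ) + 2 < K then jrow N K (n + 1) m (p + 2) (l (p + 2)) q else 0) := by
      have : ∀ j, C p j * jmat N K (n + 1) m l j q =
          (if j = p then jrow N K (n + 1) m p (l p) q else 0) -
          (if (j : ℕ) = p + 2 then xx N n ^ (l p - l (p + 2) + 1) * jrow N K (n + 1) m (p + 2) (l (p + 2)) q else 0) := by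
        intro j
        simp only [C, jmat, Matrix.of_apply]
        by_cases h1 : j = p
        · subst h1; simp
        · rw [if_neg h1, if_neg h1]
          split_ifs with h2
          · rw [h2]; ring
          · simp
      rw [Finset.sum_congr rfl fun j _ => this j, Finset.sum_sub_distrib]
      congr 1
      · simp
      · split_ifs with h
        · have : ∀ j : Fin K, ((j : ℕ) = p + 2) = (j = ⟨p + 2, h⟩) := by
            intro j; simp [Fin.ext_iff]
          simp only [this]
          simp
        · rw [mul_zero]
          apply Finset.sum_eq_zero
          intro j _
          rw [if_neg (by have := j.2; omega)]
    rw [hsum, e]; ring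
  have h1 : (jmat N K (n + 1) m l).det = (C * jmat N K (n + 1) m l).det := by
    rw [Matrix.det_mul, hC, one_mul]
  rw [h1, hCR]
  change Matrix.detRowAlternating (fun p : Fin K =>
      ∑ y ∈ Icc (l (p + 2)) (l p), xx N n ^ (l p - y) • jrow N K n m p y) = _
  rw [← AlternatingMap.coe_multilinearMap, MultilinearMap.map_sum_finset]
  unfold interF
  rw [Finset.sum_map]
  apply Finset.sum_congr rfl
  intro f hf
  rw [Fintype.mem_piFinset] at hf
  rw [MultilinearMap.map_smul_univ, smul_eq_mul]
  congr 1
  · rw [Finset.prod_pow_eq_pow_sum]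
    congr 1
    simp only [Function.Embedding.coeFn_mk, sz, Finset.sum_range, extF]
    simp only [Fin.is_lt, dif_pos, Fin.eta]
    rw [Finset.sum_tsub_distrib]
    intro i _
    exact (Finset.mem_Icc.1 (hf i)).2
  · simp only [Function.Embedding.coeFn_mk, AlternatingMap.coe_multilinearMap]
    unfold jmat
    show Matrix.det _ = Matrix.det _
    congr 1
    ext1 p q
    simp [extF]

lemma jmat_chains (N K : ℕ) (hK : K % 2 = 0) (m : ℕ → ℕ) (hm : A2 m) (hm0 : ∀ r, K ≤ r → m r = 0)
    (n : ℕ) (hn : n ≤ N) : ∀ l : ℕ → ℕ, A2 l → (∀ r, K ≤ r → l r = 0) →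
    (jmat N K n m l).det = ∑ w ∈ chains K m n l, ∏ a ∈ range n, xx N a ^ wt K w a := by
  induction n with
  | zero =>
    intro l hl hl0
    rw [jmat_zero N K m l hm hl hm0 hl0]
    unfold chains
    split_ifs <;> simp
  | succ n ih =>
    intro l hl hl0
    rw [jmat_succ N K n (by omega) hK m l hl hl0, sum_chains_succ n hl0]
    apply Finset.sum_congr rfl
    intro y hy
    have hy := (mem_interF hl0 y).1 hy
    rw [ih (by omega) y hy.A2 (hy.sup hl0), Finset.mul_sum]
    apply Finset.sum_congr rfl
    intro w hw
    have hw := (mem_chains n (hy.sup hl0) w).1 hw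
    rw [Finset.prod_range_succ, mul_comm]
    congr 1
    · apply Finset.prod_congr rfl
      intro a ha
      rw [Finset.mem_range] at ha
      congr 1
      simp only [wt]
      rw [if_pos (by omega), if_pos (by omega)]
    · congr 1
      simp only [wt]
      rw [if_neg (by omega), if_pos le_rfl, hw.top n le_rfl]

/-- interleave two row sequences -/
def il (u v : ℕ → ℕ) (r : ℕ) : ℕ := if r % 2 = 0 then u (r / 2) else v (r / 2)

lemma il_even (u v : ℕ → ℕ) (r : ℕ) : il u v (2 * r) = u r := by
  unfold il; rw [if_pos (by omega)]; congr 1; omega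

lemma il_odd (u v : ℕ → ℕ) (r : ℕ) : il u v (2 * r + 1) = v r := by
  unfold il; rw [if_neg (by omega)]; congr 1; omega

lemma jmat_prod (N k : ℕ) (l1 l2 m1 m2 : ℕ → ℕ) :
    (jmat N (k * 2) N (il m1 m2) (il l1 l2)).det = skewSchur N k l1 m1 * skewSchur N k l2 m2 := by
  classical
  have h : (jmat N (k * 2) N (il m1 m2) (il l1 l2)).submatrix finProdFinEquiv finProdFinEquiv =
    Matrix.blockDiagonal (fun b : Fin 2 => Matrix.of fun i j : Fin k =>
      homog N (((if b = 0 then l1 i else l2 i : ℕ) : ℤ) - ((if b = 0 then m1 j else m2 j : ℕ) : ℤ) - (i : ℤ) + (j : ℤ))) := by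
    ext1 ⟨i, b⟩ ⟨j, b'⟩
    rw [Matrix.blockDiagonal_apply]
    simp only [Matrix.submatrix_apply, jmat, jrow, Matrix.of_apply, finProdFinEquiv_apply_val, hh_top, il]
    fin_cases b <;> fin_cases b' <;> simp [Nat.add_mod, Nat.mul_mod_right, Nat.add_mul_div_left]
  rw [← Matrix.det_submatrix_equiv_self finProdFinEquiv, h, Matrix.det_blockDiagonal, Fin.prod_univ_two]
  simp [skewSchur]

end SB
namespace SB
open Finset

/-- partitions with at most `k` parts -/
structure Pt (k : ℕ) (x : ℕ → ℕ) : Prop where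
  anti : Antitone x
  zero : ∀ j, k ≤ j → x j = 0

lemma Pt.il_A2 {k : ℕ} {u v : ℕ → ℕ} (hu : Pt k u) (hv : Pt k v) : A2 (il u v) := by
  intro r
  unfold il
  rw [Nat.add_mod_right, Nat.add_div_right _ (by norm_num)]
  split_ifs
  · exact hu.anti (Nat.le_succ _)
  · exact hv.anti (Nat.le_succ _)

lemma Pt.il_zero {k : ℕ} {u v : ℕ → ℕ} (hu : Pt k u) (hv : Pt k v) :
    ∀ r, k * 2 ≤ r → il u v r = 0 := by
  intro r hr
  unfold il
  split_ifs
  · exact hu.zero _ (by omega)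
  · exact hv.zero _ (by omega)

lemma pair_sum {N k : ℕ} {l1 l2 m1 m2 : ℕ → ℕ} (hl1 : Pt k l1) (hl2 : Pt k l2)
    (hm1 : Pt k m1) (hm2 : Pt k m2) :
    skewSchur N k l1 m1 * skewSchur N k l2 m2 =
      ∑ w ∈ chains (k * 2) (il m1 m2) N (il l1 l2), ∏ i : Fin N, MvPolynomial.X i ^ wt (k * 2) w i := by
  rw [← jmat_prod, jmat_chains N (k * 2) (by omega) _ (hm1.il_A2 hm2) (hm1.il_zero hm2) N le_rfl _
    (hl1.il_A2 hl2) (hl1.il_zero hl2)]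
  apply Finset.sum_congr rfl
  intro w _
  rw [Finset.prod_range]
  apply Finset.prod_congr rfl
  intro i _
  simp [xx]

lemma skewSchur_symm (N k : ℕ) (l m : ℕ → ℕ) (σ : Equiv.Perm (Fin N)) :
    MvPolynomial.rename σ (skewSchur N k l m) = skewSchur N k l m := by
  unfold skewSchur
  rw [AlgHom.map_det]
  congr 1
  ext1 i j
  simp only [AlgHom.mapMatrix_apply, Matrix.map_apply, Matrix.of_apply, homog]
  split_ifs
  · exact MvPolynomial.rename_hsymm _ _ _ _
  · simp

open Classical in
lemma alt_pair {N k : ℕ} {l1 l2 m1 m2 : ℕ → ℕ} (hl1 : Pt k l1) (hl2 : Pt k l2)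
    (hm1 : Pt k m1) (hm2 : Pt k m2) :
    alt N (dl N) * (skewSchur N k l1 m1 * skewSchur N k l2 m2) =
      ∑ w ∈ chains (k * 2) (il m1 m2) N (il l1 l2) with Good N (k * 2) w,
        alt N (fun j => dl N j + wt (k * 2) w j) := by
  rw [alt_mul (dl N) _ (fun w => wt (k * 2) w) _ (pair_sum hl1 hl2 hm1 hm2)]
  · exact sum_good (by omega) (hl1.il_zero hl2) _ (mem_chains N (hl1.il_zero hl2))
  · intro σ; rw [map_mul, skewSchur_symm, skewSchur_symm]

lemma skewSchur_zero_zero (N k : ℕ) : skewSchur N k (fun _ => 0) (fun _ => 0) = 1 := by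
  unfold skewSchur
  rw [Matrix.det_of_isUpperTriangular]
  · simp [homog]
  · intro i j hij
    simp only [id] at hij
    have : (j : ℕ) < i := hij
    simp only [Matrix.of_apply, homog]
    rw [if_neg (by push_cast; omega)]

/-- the unique good chain of a straight shape -/
def w0 (κ : ℕ → ℕ) (a : ℕ) : ℕ → ℕ := il (fun r => if r < a then κ r else 0) (fun _ => 0)

lemma w0_chain {N : ℕ} {κ : ℕ → ℕ} (hκ : Pt N κ) :
    Chain N (il (fun _ => 0) fun _ => 0) (il κ fun _ => 0) (w0 κ) := by
  refine ⟨?_, ?_, ?_⟩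
  · simp [w0]
  · intro a ha
    unfold w0
    congr 1
    funext r
    split_ifs with h
    · rfl
    · rw [hκ.zero r (by omega)]
  · intro a ha r
    unfold w0 il
    rw [Nat.add_mod_right, Nat.add_div_right _ (by norm_num)]
    have := hκ.anti (Nat.le_succ (r / 2))
    simp only [Nat.succ_eq_add_one] at this
    simp only
    split_ifs <;> omega

lemma Phi_w0 {N : ℕ} (κ : ℕ → ℕ) (a τ : ℕ) (ha : a < N) :
    Phi (N * 2) (w0 κ (a + 1)) τ = Phi (N * 2) (w0 κ a) τ + (κ a - (τ + 2 * a) / (N * 2)) := by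
  unfold Phi
  rw [← Finset.add_sum_erase _ _ (Finset.mem_range.2 (by omega : 2 * a < N * 2)),
    ← Finset.add_sum_erase (range (N * 2)) (fun r => w0 κ a r - _) (Finset.mem_range.2 (by omega : 2 * a < N * 2))]
  simp only [w0, il_even]
  rw [if_pos (by omega), if_neg (by omega)]
  have : ∀ r ∈ (range (N * 2)).erase (2 * a), il (fun r => if r < a + 1 then κ r else 0) (fun _ => 0) r
      - (τ + r) / (N * 2) = il (fun r => if r < a then κ r else 0) (fun _ => 0) r - (τ + r) / (N * 2) := by
    intro r hr
    have := Finset.ne_of_mem_erase hr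
    congr 1
    unfold il
    simp only
    split_ifs <;> first | rfl | omega
  rw [Finset.sum_congr rfl this, Nat.zero_sub]
  generalize (τ + 2 * a) / (N * 2) = u
  omega

lemma w0_good {N : ℕ} {κ : ℕ → ℕ} (hκ : Pt N κ) : Good N (N * 2) (w0 κ) := by
  intro τ i hi
  rw [show i + 2 = i + 1 + 1 by ring, Phi_w0 κ (i + 1) τ (by omega), Phi_w0 κ i τ (by omega)]
  have h1 := hκ.anti (Nat.le_succ i)
  simp only [Nat.succ_eq_add_one] at h1
  have h2 : (τ + 2 * i) / (N * 2) ≤ (τ + 2 * (i + 1)) / (N * 2) := Nat.div_le_div_right (by omega)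
  omega

lemma sz_eq_Phi (K : ℕ) (x : ℕ → ℕ) : sz K x = Phi K x 0 := (Phi_zero K x).symm

lemma w0_wt {N : ℕ} (κ : ℕ → ℕ) (j : ℕ) (hj : j < N) : wt (N * 2) (w0 κ) j = κ j := by
  unfold wt
  rw [sz_eq_Phi, sz_eq_Phi, Phi_w0 κ j 0 hj, Nat.div_eq_of_lt (by omega)]
  omega

lemma w0_unique {N : ℕ} {κ : ℕ → ℕ} (hκ : Pt N κ) {w : ℕ → ℕ → ℕ}
    (hw : Chain N (il (fun _ => 0) fun _ => 0) (il κ fun _ => 0) w) (hg : Good N (N * 2) w) :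
    w = w0 κ := by
  have hodd : ∀ a r, w a (2 * r + 1) = 0 := by
    intro a r
    have := hw.le_top a (2 * r + 1)
    rw [il_odd] at this; omega
  have hle : ∀ a r, w a (2 * r) ≤ κ r := by
    intro a r
    have := hw.le_top a (2 * r)
    rwa [il_even] at this
  have hz : ∀ a r, a ≤ r → w a (2 * r) = 0 := by
    intro a
    induction a with
    | zero => intro r _; rw [hw.zero, il_even]
    | succ a ih =>
      intro r hr
      rcases Nat.lt_or_ge a N with ha | ha
      · have := (hw.step a ha (2 * (r - 1))).2
        rw [ih (r - 1) (by omega), show 2 * (r - 1) + 2 = 2 * r by omega] at this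
        omega
      · rw [hw.top _ (by omega), il_even, hκ.zero r (by omega)]
  have hfull : ∀ r a, r < a → w a (2 * r) = κ r := by
    intro r
    induction r using Nat.strong_induction_on with
    | _ r ih =>
      suffices hs : κ r ≤ w (r + 1) (2 * r) by
        intro a ha
        have h1 := hw.mono (2 * r) (show r + 1 ≤ a from ha)
        simp only at h1
        have := hle a r
        omega
      by_contra hlt
      push Not at hlt
      have hrN : r < N := by
        by_contra hh; rw [hκ.zero r (by omega)] at hlt; omega
      obtain ⟨τ, hτ⟩ : ∃ τ, τ = (κ r - 1) * (N * 2) + (N * 2 - 1 - 2 * r) := ⟨_, rfl⟩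
      have hb0 : (τ + 2 * r) / (N * 2) = κ r - 1 := by
        have : (κ r - 1 + 1) * (N * 2) = (κ r - 1) * (N * 2) + N * 2 := by ring
        apply Nat.div_eq_of_lt_le <;> omega
      have hb1 : ∀ r', r < r' → κ r ≤ (τ + 2 * r') / (N * 2) := by
        intro r' hr'
        rw [Nat.le_div_iff_mul_le (by omega)]
        have : κ r * (N * 2) = (κ r - 1) * (N * 2) + N * 2 := by
          obtain ⟨t, ht⟩ : ∃ t, κ r = t + 1 := ⟨κ r - 1, by omega⟩
          rw [ht]; simp; ring
        omega
      have f1 : Phi (N * 2) (w (r + 1)) τ ≤ Phi (N * 2) (w r) τ := by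
        apply Finset.sum_le_sum
        intro ρ _
        obtain ⟨r', rfl | rfl⟩ : ∃ r', ρ = 2 * r' ∨ ρ = 2 * r' + 1 := ⟨ρ / 2, by omega⟩
        · rcases lt_trichotomy r' r with h | h | h
          · rw [ih r' h (r + 1) (by omega), ih r' h r h]
          · subst h; rw [hb0]; omega
          · have := hb1 r' h
            have := hle (r + 1) r'
            have := hκ.anti h.le
            omega
        · rw [hodd, hodd]
      have f2 : ∀ a, r ≤ a → a < N → Phi (N * 2) (w (a + 1)) τ ≤ Phi (N * 2) (w a) τ := by
        intro a ha
        induction a, ha using Nat.le_induction with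
        | base => intro _; exact f1
        | succ a ha ih2 =>
          intro haN
          have := ih2 (by omega)
          have := hg τ a (by omega)
          rw [show a + 1 + 1 = a + 2 by ring]
          omega
      have f3 : ∀ a, r + 1 ≤ a → a ≤ N → Phi (N * 2) (w a) τ ≤ Phi (N * 2) (w (r + 1)) τ := by
        intro a ha
        induction a, ha using Nat.le_induction with
        | base => intro _; exact le_rfl
        | succ a ha ih2 =>
          intro haN
          have := ih2 (by omega)
          have := f2 a (by omega) (by omega)
          omega
      have f4 : Phi (N * 2) (w (r + 1)) τ < Phi (N * 2) (w N) τ := by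
        apply Finset.sum_lt_sum
        · intro ρ _
          have := hw.mono ρ (show r + 1 ≤ N from hrN)
          simp only at this
          omega
        · refine ⟨2 * r, Finset.mem_range.2 (by omega), ?_⟩
          rw [hb0, hw.top N le_rfl, il_even]
          omega
      have := f3 N (by omega) le_rfl
      omega
  funext a ρ
  obtain ⟨r', rfl | rfl⟩ : ∃ r', ρ = 2 * r' ∨ ρ = 2 * r' + 1 := ⟨ρ / 2, by omega⟩
  · unfold w0; rw [il_even]
    split_ifs with h
    · exact hfull _ _ h
    · exact hz _ _ (by omega)
  · unfold w0; rw [il_odd, hodd]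

lemma Pt.zero_fun (k : ℕ) : Pt k (fun _ => 0) := ⟨fun _ _ _ => le_rfl, fun _ _ => rfl⟩

lemma alt_congr {N : ℕ} {β β' : ℕ → ℕ} (h : ∀ j, j < N → β j = β' j) : alt N β = alt N β' := by
  unfold alt
  congr 1
  ext1 i j
  simp only [Matrix.of_apply]
  rw [h j j.2]

lemma alt_straight {N : ℕ} {κ : ℕ → ℕ} (hκ : Pt N κ) :
    alt N (dl N) * skewSchur N N κ (fun _ => 0) = alt N (fun j => dl N j + κ j) := by
  classical
  have h := alt_pair (N := N) hκ (Pt.zero_fun N) (Pt.zero_fun N) (Pt.zero_fun N)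
  rw [skewSchur_zero_zero, mul_one] at h
  rw [h]
  have : ((chains (N * 2) (il (fun _ => 0) fun _ => 0) N (il κ fun _ => 0)).filter
      fun w => Good N (N * 2) w) = {w0 κ} := by
    ext w
    rw [Finset.mem_filter, mem_chains N (hκ.il_zero (Pt.zero_fun N)), Finset.mem_singleton]
    constructor
    · rintro ⟨h1, h2⟩; exact w0_unique hκ h1 h2
    · rintro rfl; exact ⟨w0_chain hκ, w0_good hκ⟩
  rw [this, Finset.sum_singleton]
  apply alt_congr
  intro j hj
  rw [w0_wt κ j hj]

open Classical in
/-- Littlewood–Richardson rule for a product of two skew Schur polynomials. -/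
theorem LR {N k : ℕ} {l1 l2 m1 m2 : ℕ → ℕ} (hl1 : Pt k l1) (hl2 : Pt k l2)
    (hm1 : Pt k m1) (hm2 : Pt k m2) :
    skewSchur N k l1 m1 * skewSchur N k l2 m2 =
      ∑ w ∈ chains (k * 2) (il m1 m2) N (il l1 l2) with Good N (k * 2) w,
        skewSchur N N (wt (k * 2) w) (fun _ => 0) := by
  apply mul_left_cancel₀ (alt_dl_ne_zero N)
  rw [alt_pair hl1 hl2 hm1 hm2, Finset.mul_sum]
  apply Finset.sum_congr rfl
  intro w hw
  rw [Finset.mem_filter, mem_chains N (hl1.il_zero hl2)] at hw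
  have h := Good.antitone hw.1 hw.2
  rw [alt_straight ⟨h.1, h.2⟩]

/-- the cone generated by Schur polynomials -/
noncomputable def Cone (N : ℕ) : AddSubmonoid (MvPolynomial (Fin N) ℤ) :=
  AddSubmonoid.closure {f | ∃ κ, Pt N κ ∧ f = skewSchur N N κ (fun _ => 0)}

lemma pair_mem_Cone {N k : ℕ} {l1 l2 m1 m2 : ℕ → ℕ} (hl1 : Pt k l1) (hl2 : Pt k l2)
    (hm1 : Pt k m1) (hm2 : Pt k m2) : skewSchur N k l1 m1 * skewSchur N k l2 m2 ∈ Cone N := by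
  classical
  rw [LR hl1 hl2 hm1 hm2]
  apply AddSubmonoid.sum_mem
  intro w hw
  rw [Finset.mem_filter, mem_chains N (hl1.il_zero hl2)] at hw
  have h := Good.antitone hw.1 hw.2
  exact AddSubmonoid.subset_closure ⟨_, ⟨h.1, h.2⟩, rfl⟩

lemma mem_Cone {N k : ℕ} {l1 m1 : ℕ → ℕ} (hl1 : Pt k l1) (hm1 : Pt k m1) :
    skewSchur N k l1 m1 ∈ Cone N := by
  have := pair_mem_Cone (N := N) hl1 (Pt.zero_fun k) hm1 (Pt.zero_fun k)
  rwa [skewSchur_zero_zero, mul_one] at this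

lemma Cone.mul {N : ℕ} {f g : MvPolynomial (Fin N) ℤ} (hf : f ∈ Cone N) (hg : g ∈ Cone N) :
    f * g ∈ Cone N := by
  induction hf using AddSubmonoid.closure_induction with
  | zero => rw [zero_mul]; exact zero_mem _
  | add x y _ _ hx hy => rw [add_mul]; exact add_mem hx hy
  | mem x hx =>
    obtain ⟨κ, hκ, rfl⟩ := hx
    induction hg using AddSubmonoid.closure_induction with
    | zero => rw [mul_zero]; exact zero_mem _
    | add x y _ _ hx hy => rw [mul_add]; exact add_mem hx hy
    | mem x hx =>
      obtain ⟨κ', hκ', rfl⟩ := hx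
      exact pair_mem_Cone hκ hκ' (Pt.zero_fun N) (Pt.zero_fun N)

lemma Cone.one {N : ℕ} : (1 : MvPolynomial (Fin N) ℤ) ∈ Cone N := by
  have := mem_Cone (N := N) (Pt.zero_fun 0) (Pt.zero_fun 0)
  rwa [skewSchur_zero_zero] at this

lemma Cone.nonneg {N : ℕ} {f : MvPolynomial (Fin N) ℤ} (hf : f ∈ Cone N) : IsSchurNonneg N f := by
  induction hf using AddSubmonoid.closure_induction with
  | zero => exact ⟨0, Fin.elim0, Fin.elim0, Fin.elim0, fun i => i.elim0, fun i => i.elim0, by simp⟩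
  | mem x hx =>
    obtain ⟨κ, hκ, rfl⟩ := hx
    exact ⟨1, fun _ => 1, fun _ => N, fun _ => κ, fun _ => hκ.anti, fun _ => hκ.zero, by simp⟩
  | add x y _ _ hx hy =>
    obtain ⟨m, c, k, l, h1, h2, h3⟩ := hx
    obtain ⟨m', c', k', l', h1', h2', h3'⟩ := hy
    refine ⟨m + m', Fin.append c c', Fin.append k k', Fin.append l l', ?_, ?_, ?_⟩
    · intro i; refine Fin.addCases (fun i => ?_) (fun i => ?_) i
      · rw [Fin.append_left]; exact h1 i
      · rw [Fin.append_right]; exact h1' i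
    · intro i; refine Fin.addCases (fun i => ?_) (fun i => ?_) i
      · rw [Fin.append_left, Fin.append_left]; exact h2 i
      · rw [Fin.append_right, Fin.append_right]; exact h2' i
    · rw [h3, h3', Fin.sum_univ_add]
      simp only [Fin.append_left, Fin.append_right]

end SB
namespace SB
open Finset

/-! ### letters -/
def Lw (N : ℕ) (w : ℕ → ℕ → ℕ) (r s : ℕ) : ℕ := #{a ∈ range (N + 1) | w a r ≤ s}

lemma Lw_le (N : ℕ) (w : ℕ → ℕ → ℕ) (r s : ℕ) : Lw N w r s ≤ N + 1 := by
  unfold Lw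
  exact (card_filter_le _ _).trans (by simp)

lemma Chain.lt_iff {N : ℕ} {m l : ℕ → ℕ} {w : ℕ → ℕ → ℕ} (h : Chain N m l w) (a r s : ℕ) :
    s < w a r ↔ Lw N w r s ≤ min a N := by
  have key : ∀ a, a ≤ N → (s < w a r ↔ Lw N w r s ≤ a) := by
    intro a ha
    unfold Lw
    constructor
    · intro hs
      calc _ ≤ #(range a) := by
            apply card_le_card
            intro b hb
            rw [mem_filter] at hb
            rw [mem_range]
            by_contra hab
            have := h.mono r (not_lt.1 hab)
            simp only at this
            omega
        _ = a := card_range a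
    · intro hc
      by_contra hs
      have : #(range (a + 1)) ≤ #{a ∈ range (N + 1) | w a r ≤ s} := by
        apply card_le_card
        intro b hb
        rw [mem_range] at hb
        rw [mem_filter, mem_range]
        have := h.mono r (show b ≤ a by omega)
        simp only at this
        omega
      rw [card_range] at this
      omega
  rcases Nat.le_total a N with ha | ha
  · rw [min_eq_left ha, key a ha]
  · rw [min_eq_right ha, h.top a ha, ← h.top N le_rfl, key N le_rfl]

/-- column relation -/
def Cr (N x y : ℕ) : Prop := x < y ∨ (x = y ∧ (x = 0 ∨ x = N + 1))

lemma Lw_row (N : ℕ) (w : ℕ → ℕ → ℕ) (r s : ℕ) : Lw N w r s ≤ Lw N w r (s + 1) := by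
  unfold Lw
  apply card_le_card
  intro b hb
  rw [mem_filter] at hb ⊢
  exact ⟨hb.1, by omega⟩

lemma Chain.col {N : ℕ} {m l : ℕ → ℕ} {w : ℕ → ℕ → ℕ} (h : Chain N m l w) (hm : A2 m) (hl : A2 l)
    (r s : ℕ) : Cr N (Lw N w r s) (Lw N w (r + 2) s) := by
  have h1 := Lw_le N w r s
  have h2 := Lw_le N w (r + 2) s
  have h3 : ∀ a, a < N → Lw N w (r + 2) s ≤ a + 1 → Lw N w r s ≤ a := by
    intro a ha hh
    have e1 := (h.lt_iff (a + 1) (r + 2) s).2 (by omega)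
    have e2 := (h.step a ha r).2
    have := (h.lt_iff a r s).1 (by omega)
    omega
  have h4 : Lw N w (r + 2) s ≤ N → Lw N w r s ≤ N := by
    intro hh
    have e1 := (h.lt_iff N (r + 2) s).2 (by omega)
    rw [h.top N le_rfl] at e1
    have e2 := hl r
    have := (h.lt_iff N r s).1 (by rw [h.top N le_rfl]; omega)
    omega
  have h5 : Lw N w (r + 2) s = 0 → Lw N w r s = 0 := by
    intro hh
    have e1 := (h.lt_iff 0 (r + 2) s).2 (by omega)
    rw [h.zero] at e1
    have e2 := hm r
    have := (h.lt_iff 0 r s).1 (by rw [h.zero]; omega)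
    omega
  unfold Cr
  have h6 := h3 (Lw N w (r + 2) s - 1)
  omega

/-- chain of a letter array -/
noncomputable def wE (N : ℕ) (E : ℕ → ℕ → ℕ) (a r : ℕ) : ℕ := sInf {s | min a N < E r s}

structure Arr (N : ℕ) (m l : ℕ → ℕ) (E : ℕ → ℕ → ℕ) : Prop where
  row : ∀ r s, E r s ≤ E r (s + 1)
  col : ∀ r s, Cr N (E r s) (E (r + 2) s)
  le : ∀ r s, E r s ≤ N + 1
  bot : ∀ r s, E r s = 0 ↔ s < m r
  top : ∀ r s, E r s ≤ N ↔ s < l r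

lemma Arr.lt_iff {N : ℕ} {m l : ℕ → ℕ} {E : ℕ → ℕ → ℕ} (h : Arr N m l E) (a r s : ℕ) :
    s < wE N E a r ↔ E r s ≤ min a N := by
  have hne : {s | min a N < E r s}.Nonempty := by
    refine ⟨l r, ?_⟩
    have := h.top r (l r)
    simp only [Set.mem_setOf_eq]
    omega
  have hmem := Nat.sInf_mem hne
  have hmono : Monotone (E r) := monotone_nat_of_le_succ (h.row r)
  constructor
  · intro hs
    have := Nat.notMem_of_lt_sInf hs
    simp only [Set.mem_setOf_eq] at this
    omega
  · intro hs
    by_contra hh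
    have := hmono (not_lt.1 hh)
    simp only [Set.mem_setOf_eq] at hmem
    unfold wE at this
    omega

lemma eq_of_lt {a b : ℕ} (h : ∀ s, s < a ↔ s < b) : a = b := by
  have h1 := h a
  have h2 := h b
  omega

lemma Arr.chain {N : ℕ} {m l : ℕ → ℕ} {E : ℕ → ℕ → ℕ} (h : Arr N m l E) : Chain N m l (wE N E) := by
  refine ⟨?_, ?_, ?_⟩
  · funext r
    apply eq_of_lt
    intro s
    rw [h.lt_iff, ← h.bot]; omega
  · intro a ha
    funext r
    apply eq_of_lt
    intro s
    rw [h.lt_iff, ← h.top, min_eq_right ha]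
  · intro a ha r
    constructor
    · by_contra hh
      have h1 := (h.lt_iff a r _).1 (not_le.1 hh)
      have h2 := (h.lt_iff (a + 1) r (wE N E (a + 1) r))
      omega
    · by_contra hh
      have h1 := (h.lt_iff (a + 1) (r + 2) _).1 (not_le.1 hh)
      have h2 := (h.lt_iff a r (wE N E a r))
      have h3 := h.col r (wE N E a r)
      unfold Cr at h3
      omega

lemma Arr.Lw_eq {N : ℕ} {m l : ℕ → ℕ} {E : ℕ → ℕ → ℕ} (h : Arr N m l E) : Lw N (wE N E) = E := by
  funext r s
  have h1 : ∀ a, a ≤ N → (Lw N (wE N E) r s ≤ a ↔ E r s ≤ a) := by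
    intro a ha
    have := h.chain.lt_iff a r s
    rw [h.lt_iff, min_eq_left ha] at this
    exact this.symm
  have h2 := Lw_le N (wE N E) r s
  have h3 := h.le r s
  have h4 := h1 (Lw N (wE N E) r s)
  have h5 := h1 (E r s)
  omega

lemma Chain.ext_Lw {N : ℕ} {m l : ℕ → ℕ} {w w' : ℕ → ℕ → ℕ} (h : Chain N m l w) (h' : Chain N m l w')
    (e : Lw N w = Lw N w') : w = w' := by
  funext a r
  apply eq_of_lt
  intro s
  rw [h.lt_iff, h'.lt_iff, e]

/-! ### The swapped region -/
def lkR (x y x' y' : ℕ) : Prop := ¬ (x ≤ x' ∧ x ≤ y' ∧ y ≤ x' ∧ y ≤ y')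
def lkC (N x y x' y' : ℕ) : Prop := ¬ (Cr N x x' ∧ Cr N x y' ∧ Cr N y x' ∧ Cr N y y')

inductive Reg (N : ℕ) (F : ℕ → ℕ → Prop) (x y : ℕ → ℕ → ℕ) : ℕ → ℕ → Prop
  | base (r s) : F r s → Reg N F x y r s
  | right (r s) : Reg N F x y r s → lkR (x r s) (y r s) (x r (s + 1)) (y r (s + 1)) → Reg N F x y r (s + 1)
  | left (r s) : Reg N F x y r (s + 1) → lkR (x r s) (y r s) (x r (s + 1)) (y r (s + 1)) → Reg N F x y r s
  | down (r s) : Reg N F x y r s → lkC N (x r s) (y r s) (x (r + 1) s) (y (r + 1) s) → Reg N F x y (r + 1) s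
  | up (r s) : Reg N F x y (r + 1) s → lkC N (x r s) (y r s) (x (r + 1) s) (y (r + 1) s) → Reg N F x y r s

lemma Reg.congr {N : ℕ} {F : ℕ → ℕ → Prop} {x y X Y : ℕ → ℕ → ℕ}
    (h : ∀ r s, (x r s = X r s ∧ y r s = Y r s) ∨ (x r s = Y r s ∧ y r s = X r s))
    {r s : ℕ} (hr : Reg N F x y r s) : Reg N F X Y r s := by
  have hR : ∀ r s, lkR (x r s) (y r s) (x r (s + 1)) (y r (s + 1)) →
      lkR (X r s) (Y r s) (X r (s + 1)) (Y r (s + 1)) := by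
    intro r s
    have h1 := h r s
    have h2 := h r (s + 1)
    unfold lkR
    omega
  have hC : ∀ r s, lkC N (x r s) (y r s) (x (r + 1) s) (y (r + 1) s) →
      lkC N (X r s) (Y r s) (X (r + 1) s) (Y (r + 1) s) := by
    intro r s
    have h1 := h r s
    have h2 := h (r + 1) s
    unfold lkC
    rcases h1 with ⟨e1, e2⟩ | ⟨e1, e2⟩ <;> rcases h2 with ⟨e3, e4⟩ | ⟨e3, e4⟩ <;>
      rw [e1, e2, e3, e4] <;> tauto
  induction hr with
  | base r s h => exact .base r s h
  | right r s _ hl ih => exact .right r s ih (hR _ _ hl)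
  | left r s _ hl ih => exact .left r s ih (hR _ _ hl)
  | down r s _ hl ih => exact .down r s ih (hC _ _ hl)
  | up r s _ hl ih => exact .up r s ih (hC _ _ hl)

structure Cfg (N : ℕ) (F : ℕ → ℕ → Prop) (x y : ℕ → ℕ → ℕ) : Prop where
  rx : ∀ r s, x r s ≤ x r (s + 1)
  ry : ∀ r s, y r s ≤ y r (s + 1)
  cx : ∀ r s, Cr N (x r s) (x (r + 1) s)
  cy : ∀ r s, Cr N (y r s) (y (r + 1) s)
  lx : ∀ r s, x r s ≤ N + 1
  ly : ∀ r s, y r s ≤ N + 1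
  hF : ∀ r s, F r s ↔ (x r s = N + 1 ∧ y r s ≤ N) ∨ (1 ≤ x r s ∧ y r s = 0)

lemma Cfg.lt {N : ℕ} {F : ℕ → ℕ → Prop} {x y : ℕ → ℕ → ℕ} (h : Cfg N F x y) {r s : ℕ}
    (hr : Reg N F x y r s) : y r s < x r s := by
  induction hr with
  | base r s hf => have := (h.hF r s).1 hf; omega
  | right r s _ hl ih =>
    have h1 := h.rx r s
    have h2 := h.ry r s
    unfold lkR at hl; omega
  | left r s _ hl ih =>
    have h1 := h.rx r s
    have h2 := h.ry r s
    unfold lkR at hl; omega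
  | down r s _ hl ih =>
    have h1 := h.cx r s
    have h2 := h.cy r s
    have h3 := h.lx r s
    have h4 := h.ly r s
    have h5 := h.lx (r + 1) s
    have h6 := h.ly (r + 1) s
    unfold lkC Cr at hl; unfold Cr at h1 h2; omega
  | up r s _ hl ih =>
    have h1 := h.cx r s
    have h2 := h.cy r s
    have h3 := h.lx r s
    have h4 := h.ly r s
    have h5 := h.lx (r + 1) s
    have h6 := h.ly (r + 1) s
    unfold lkC Cr at hl; unfold Cr at h1 h2; omega

open Classical in
noncomputable def swX (N : ℕ) (F : ℕ → ℕ → Prop) (x y : ℕ → ℕ → ℕ) (r s : ℕ) : ℕ :=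
  if Reg N F x y r s then y r s else x r s
open Classical in
noncomputable def swY (N : ℕ) (F : ℕ → ℕ → Prop) (x y : ℕ → ℕ → ℕ) (r s : ℕ) : ℕ :=
  if Reg N F x y r s then x r s else y r s

lemma Cfg.sw_row {N : ℕ} {F : ℕ → ℕ → Prop} {x y : ℕ → ℕ → ℕ} (h : Cfg N F x y) (r s : ℕ) :
    swX N F x y r s ≤ swX N F x y r (s + 1) ∧ swY N F x y r s ≤ swY N F x y r (s + 1) := by
  have h1 := h.rx r s
  have h2 := h.ry r s
  unfold swX swY
  by_cases hl : lkR (x r s) (y r s) (x r (s + 1)) (y r (s + 1))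
  · by_cases hr : Reg N F x y r s
    · rw [if_pos hr, if_pos hr, if_pos (hr.right r s hl), if_pos (hr.right r s hl)]; omega
    · have hr' : ¬ Reg N F x y r (s + 1) := fun hh => hr (hh.left r s hl)
      rw [if_neg hr, if_neg hr, if_neg hr', if_neg hr']; omega
  · unfold lkR at hl
    split_ifs <;> omega

lemma Cfg.sw_col {N : ℕ} {F : ℕ → ℕ → Prop} {x y : ℕ → ℕ → ℕ} (h : Cfg N F x y) (r s : ℕ) :
    Cr N (swX N F x y r s) (swX N F x y (r + 1) s) ∧ Cr N (swY N F x y r s) (swY N F x y (r + 1) s) := by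
  have h1 := h.cx r s
  have h2 := h.cy r s
  unfold swX swY
  by_cases hl : lkC N (x r s) (y r s) (x (r + 1) s) (y (r + 1) s)
  · by_cases hr : Reg N F x y r s
    · rw [if_pos hr, if_pos hr, if_pos (hr.down r s hl), if_pos (hr.down r s hl)]; exact ⟨h2, h1⟩
    · have hr' : ¬ Reg N F x y (r + 1) s := fun hh => hr (hh.up r s hl)
      rw [if_neg hr, if_neg hr, if_neg hr', if_neg hr']; exact ⟨h1, h2⟩
  · unfold lkC at hl
    push Not at hl
    split_ifs <;> tauto

lemma Cfg.sw_bot {N : ℕ} {F : ℕ → ℕ → Prop} {x y : ℕ → ℕ → ℕ} (h : Cfg N F x y) (r s : ℕ) :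
    (swX N F x y r s = 0 ↔ x r s = 0 ∨ y r s = 0) ∧ (swY N F x y r s = 0 ↔ x r s = 0 ∧ y r s = 0) ∧
    (swX N F x y r s ≤ N ↔ x r s ≤ N ∨ y r s ≤ N) ∧ (swY N F x y r s ≤ N ↔ x r s ≤ N ∧ y r s ≤ N) ∧
    swX N F x y r s ≤ N + 1 ∧ swY N F x y r s ≤ N + 1 := by
  have h1 := h.lx r s
  have h2 := h.ly r s
  unfold swX swY
  by_cases hr : Reg N F x y r s
  · have := h.lt hr
    simp only [if_pos hr]; omega
  · have : ¬ F r s := fun hf => hr (.base r s hf)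
    rw [h.hF] at this
    simp only [if_neg hr]; omega

/-- interleaving of two arrays -/
def ilE (x y : ℕ → ℕ → ℕ) (r s : ℕ) : ℕ := if r % 2 = 0 then x (r / 2) s else y (r / 2) s

lemma ilE_even (u v : ℕ → ℕ → ℕ) (r s : ℕ) : ilE u v (2 * r) s = u r s := by
  unfold ilE; rw [if_pos (by omega)]; congr 1; omega

lemma ilE_odd (u v : ℕ → ℕ → ℕ) (r s : ℕ) : ilE u v (2 * r + 1) s = v r s := by
  unfold ilE; rw [if_neg (by omega)]; congr 1; omega

section main
variable {N k : ℕ} {l1 l2 m1 m2 : ℕ → ℕ}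

def F0 (l1 l2 m1 m2 : ℕ → ℕ) (r s : ℕ) : Prop := (l1 r ≤ s ∧ s < l2 r) ∨ (m1 r ≤ s ∧ s < m2 r)

def xT (N : ℕ) (w : ℕ → ℕ → ℕ) (r s : ℕ) : ℕ := Lw N w (2 * r) s
def yT (N : ℕ) (w : ℕ → ℕ → ℕ) (r s : ℕ) : ℕ := Lw N w (2 * r + 1) s

lemma cfg_of (hl1 : Pt k l1) (hl2 : Pt k l2) (hm1 : Pt k m1) (hm2 : Pt k m2)
    {w : ℕ → ℕ → ℕ} (hw : Chain N (il m1 m2) (il l1 l2) w) :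
    Cfg N (F0 l1 l2 m1 m2) (xT N w) (yT N w) where
  rx := fun r s => Lw_row _ _ _ _
  ry := fun r s => Lw_row _ _ _ _
  cx := fun r s => hw.col (hm1.il_A2 hm2) (hl1.il_A2 hl2) (2 * r) s
  cy := fun r s => hw.col (hm1.il_A2 hm2) (hl1.il_A2 hl2) (2 * r + 1) s
  lx := fun r s => Lw_le _ _ _ _
  ly := fun r s => Lw_le _ _ _ _
  hF := fun r s => by
    have a1 := hw.lt_iff 0 (2 * r) s
    have a2 := hw.lt_iff 0 (2 * r + 1) s
    have a3 := hw.lt_iff N (2 * r) s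
    have a4 := hw.lt_iff N (2 * r + 1) s
    rw [hw.zero] at a1 a2
    rw [hw.top N le_rfl] at a3 a4
    rw [il_even] at a1 a3
    rw [il_odd] at a2 a4
    have b1 := Lw_le N w (2 * r) s
    have b2 := Lw_le N w (2 * r + 1) s
    unfold F0 xT yT
    omega

noncomputable def newE (N : ℕ) (F : ℕ → ℕ → Prop) (w : ℕ → ℕ → ℕ) : ℕ → ℕ → ℕ :=
  ilE (swX N F (xT N w) (yT N w)) (swY N F (xT N w) (yT N w))

lemma arr_new (hl1 : Pt k l1) (hl2 : Pt k l2) (hm1 : Pt k m1) (hm2 : Pt k m2)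
    {w : ℕ → ℕ → ℕ} (hw : Chain N (il m1 m2) (il l1 l2) w) :
    Arr N (il (fun r => max (m1 r) (m2 r)) (fun r => min (m1 r) (m2 r)))
      (il (fun r => max (l1 r) (l2 r)) (fun r => min (l1 r) (l2 r)))
      (newE N (F0 l1 l2 m1 m2) w) := by
  have hc := cfg_of hl1 hl2 hm1 hm2 hw
  have par : ∀ ρ : ℕ, ∃ r, ρ = 2 * r ∨ ρ = 2 * r + 1 := fun ρ => ⟨ρ / 2, by omega⟩
  unfold newE
  have shp : ∀ r s, ((s < m1 r ↔ xT N w r s = 0) ∧ (s < m2 r ↔ yT N w r s = 0)) ∧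
      (s < l1 r ↔ xT N w r s ≤ N) ∧ (s < l2 r ↔ yT N w r s ≤ N) := by
    intro r s
    have a1 := hw.lt_iff 0 (2 * r) s
    have a2 := hw.lt_iff 0 (2 * r + 1) s
    have a3 := hw.lt_iff N (2 * r) s
    have a4 := hw.lt_iff N (2 * r + 1) s
    rw [hw.zero] at a1 a2
    rw [hw.top N le_rfl] at a3 a4
    rw [il_even] at a1 a3
    rw [il_odd] at a2 a4
    unfold xT yT
    omega
  refine ⟨?_, ?_, ?_, ?_, ?_⟩
  · intro ρ s
    obtain ⟨r, rfl | rfl⟩ := par ρ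
    · rw [ilE_even, ilE_even]; exact (hc.sw_row r s).1
    · rw [ilE_odd, ilE_odd]; exact (hc.sw_row r s).2
  · intro ρ s
    obtain ⟨r, rfl | rfl⟩ := par ρ
    · rw [show 2 * r + 2 = 2 * (r + 1) by ring, ilE_even, ilE_even]; exact (hc.sw_col r s).1
    · rw [show 2 * r + 1 + 2 = 2 * (r + 1) + 1 by ring, ilE_odd, ilE_odd]; exact (hc.sw_col r s).2
  · intro ρ s
    have hh := fun r => hc.sw_bot r s
    obtain ⟨r, rfl | rfl⟩ := par ρ
    · rw [ilE_even]; exact (hh r).2.2.2.2.1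
    · rw [ilE_odd]; exact (hh r).2.2.2.2.2
  · intro ρ s
    obtain ⟨r, rfl | rfl⟩ := par ρ
    · have h1 := shp r s
      rw [ilE_even, il_even, (hc.sw_bot r s).1]; omega
    · have h1 := shp r s
      rw [ilE_odd, il_odd, (hc.sw_bot r s).2.1]; omega
  · intro ρ s
    obtain ⟨r, rfl | rfl⟩ := par ρ
    · have h1 := shp r s
      rw [ilE_even, il_even, (hc.sw_bot r s).2.2.1]; omega
    · have h1 := shp r s
      rw [ilE_odd, il_odd, (hc.sw_bot r s).2.2.2.1]; omega

noncomputable def xfer (N : ℕ) (F : ℕ → ℕ → Prop) (w : ℕ → ℕ → ℕ) : ℕ → ℕ → ℕ := wE N (newE N F w)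

lemma xfer_inj (hl1 : Pt k l1) (hl2 : Pt k l2) (hm1 : Pt k m1) (hm2 : Pt k m2)
    {w w' : ℕ → ℕ → ℕ} (hw : Chain N (il m1 m2) (il l1 l2) w) (hw' : Chain N (il m1 m2) (il l1 l2) w')
    (e : xfer N (F0 l1 l2 m1 m2) w = xfer N (F0 l1 l2 m1 m2) w') : w = w' := by
  have h1 := (arr_new hl1 hl2 hm1 hm2 hw).Lw_eq
  have h2 := (arr_new hl1 hl2 hm1 hm2 hw').Lw_eq
  have e3 : newE N (F0 l1 l2 m1 m2) w = newE N (F0 l1 l2 m1 m2) w' := by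
    rw [← h1, ← h2]; exact congrArg (Lw N) e
  obtain ⟨F, hF⟩ : ∃ F, F = F0 l1 l2 m1 m2 := ⟨_, rfl⟩
  rw [← hF] at e3
  unfold newE at e3
  have eX : swX N F (xT N w) (yT N w) = swX N F (xT N w') (yT N w') := by
    funext r s
    have := congrFun (congrFun e3 (2 * r)) s
    rwa [ilE_even, ilE_even] at this
  have eY : swY N F (xT N w) (yT N w) = swY N F (xT N w') (yT N w') := by
    funext r s
    have := congrFun (congrFun e3 (2 * r + 1)) s
    rwa [ilE_odd, ilE_odd] at this
  have un : ∀ w : ℕ → ℕ → ℕ, ∀ r s, (xT N w r s = swX N F (xT N w) (yT N w) r s ∧ yT N w r s = swY N F (xT N w) (yT N w) r s) ∨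
      (xT N w r s = swY N F (xT N w) (yT N w) r s ∧ yT N w r s = swX N F (xT N w) (yT N w) r s) := by
    intro w r s
    unfold swX swY
    split_ifs <;> simp
  have un' : ∀ w : ℕ → ℕ → ℕ, ∀ r s, (swX N F (xT N w) (yT N w) r s = xT N w r s ∧ swY N F (xT N w) (yT N w) r s = yT N w r s) ∨
      (swX N F (xT N w) (yT N w) r s = yT N w r s ∧ swY N F (xT N w) (yT N w) r s = xT N w r s) := by
    intro w r s
    unfold swX swY
    split_ifs <;> simp
  have hreg : ∀ r s, Reg N F (xT N w) (yT N w) r s ↔ Reg N F (xT N w') (yT N w') r s := by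
    intro r s
    constructor
    · intro h
      have := h.congr (un w)
      rw [eX, eY] at this
      exact this.congr (un' w')
    · intro h
      have := h.congr (un w')
      rw [← eX, ← eY] at this
      exact this.congr (un' w)
  have exy : ∀ r s, xT N w r s = xT N w' r s ∧ yT N w r s = yT N w' r s := by
    intro r s
    have f1 := congrFun (congrFun eX r) s
    have f2 := congrFun (congrFun eY r) s
    have f3 := hreg r s
    unfold swX at f1
    unfold swY at f2
    by_cases hr : Reg N F (xT N w) (yT N w) r s
    · rw [if_pos hr, if_pos (f3.1 hr)] at f1 f2; exact ⟨f2, f1⟩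
    · rw [if_neg hr, if_neg (fun hh => hr (f3.2 hh))] at f1 f2; exact ⟨f1, f2⟩
  apply hw.ext_Lw hw'
  funext ρ s
  obtain ⟨r, rfl | rfl⟩ : ∃ r, ρ = 2 * r ∨ ρ = 2 * r + 1 := ⟨ρ / 2, by omega⟩
  · exact (exy r s).1
  · exact (exy r s).2

lemma Phi_pair (k : ℕ) (hk : 0 < k) (j : ℕ) : ∃ s r, ∀ x : ℕ → ℕ,
    Phi (k * 2) x (2 * j + 1) = Phi (k * 2) x (2 * j + 2) + (if s < x (2 * r) then 1 else 0) ∧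
    Phi (k * 2) x (2 * j) = Phi (k * 2) x (2 * j + 2) + (if s < x (2 * r) then 1 else 0)
      + (if s < x (2 * r + 1) then 1 else 0) := by
  obtain ⟨s, ρ, hρ, e⟩ := pos_decomp (k * 2) (by omega) (2 * j + 1)
  have e' : 2 * j + 1 = 2 * (s * k) + (k * 2 - 1 - ρ) := by rw [e]; ring
  obtain ⟨r, rfl⟩ : ∃ r, ρ = 2 * r := ⟨ρ / 2, by omega⟩
  refine ⟨s, r, fun x => ?_⟩
  have h1 := Phi_step (k * 2) x s (2 * r) hρ
  have h2 := Phi_step (k * 2) x s (2 * r + 1) (by omega)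
  rw [← e] at h1
  rw [show s * (k * 2) + (k * 2 - 1 - (2 * r + 1)) = 2 * j by omega] at h2
  exact ⟨h1, by rw [h2, h1]⟩

lemma xfer_cell (hl1 : Pt k l1) (hl2 : Pt k l2) (hm1 : Pt k m1) (hm2 : Pt k m2)
    {w : ℕ → ℕ → ℕ} (hw : Chain N (il m1 m2) (il l1 l2) w) (r s : ℕ) :
    (∀ a, (s < xfer N (F0 l1 l2 m1 m2) w a (2 * r) ↔ s < w a (2 * r)) ∧
      (s < xfer N (F0 l1 l2 m1 m2) w a (2 * r + 1) ↔ s < w a (2 * r + 1))) ∨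
    ∃ x y, y < x ∧ ∀ a, (s < w a (2 * r) ↔ x ≤ min a N) ∧ (s < w a (2 * r + 1) ↔ y ≤ min a N) ∧
      (s < xfer N (F0 l1 l2 m1 m2) w a (2 * r) ↔ y ≤ min a N) ∧
      (s < xfer N (F0 l1 l2 m1 m2) w a (2 * r + 1) ↔ x ≤ min a N) := by
  have hc := cfg_of hl1 hl2 hm1 hm2 hw
  have ha := arr_new hl1 hl2 hm1 hm2 hw
  have g1 : ∀ a, s < xfer N (F0 l1 l2 m1 m2) w a (2 * r) ↔
      swX N (F0 l1 l2 m1 m2) (xT N w) (yT N w) r s ≤ min a N := by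
    intro a; unfold xfer; rw [ha.lt_iff]; unfold newE; rw [ilE_even]
  have g2 : ∀ a, s < xfer N (F0 l1 l2 m1 m2) w a (2 * r + 1) ↔
      swY N (F0 l1 l2 m1 m2) (xT N w) (yT N w) r s ≤ min a N := by
    intro a; unfold xfer; rw [ha.lt_iff]; unfold newE; rw [ilE_odd]
  by_cases hr : Reg N (F0 l1 l2 m1 m2) (xT N w) (yT N w) r s
  · right
    refine ⟨xT N w r s, yT N w r s, hc.lt hr, fun a => ?_⟩
    rw [g1, g2, hw.lt_iff, hw.lt_iff]
    unfold swX swY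
    rw [if_pos hr, if_pos hr]
    exact ⟨Iff.rfl, Iff.rfl, Iff.rfl, Iff.rfl⟩
  · left
    intro a
    rw [g1, g2, hw.lt_iff, hw.lt_iff]
    unfold swX swY
    rw [if_neg hr, if_neg hr]
    exact ⟨Iff.rfl, Iff.rfl⟩

lemma xfer_Phi_even (hl1 : Pt k l1) (hl2 : Pt k l2) (hm1 : Pt k m1) (hm2 : Pt k m2)
    {w : ℕ → ℕ → ℕ} (hw : Chain N (il m1 m2) (il l1 l2) w) (a j : ℕ) :
    Phi (k * 2) (xfer N (F0 l1 l2 m1 m2) w a) (2 * j) = Phi (k * 2) (w a) (2 * j) := by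
  rcases Nat.eq_zero_or_pos k with rfl | hk
  · simp [Phi]
  have hw' := (arr_new hl1 hl2 hm1 hm2 hw).chain
  obtain ⟨B, hB⟩ : ∃ B, B = k * 2 * sz (k * 2) (il l1 l2) +
      k * 2 * sz (k * 2) (il (fun r => max (l1 r) (l2 r)) (fun r => min (l1 r) (l2 r))) := ⟨_, rfl⟩
  suffices h : ∀ d j, B ≤ j + d → Phi (k * 2) (xfer N (F0 l1 l2 m1 m2) w a) (2 * j) = Phi (k * 2) (w a) (2 * j) from
    h B j (by omega)
  intro d
  induction d with
  | zero =>
    intro j hj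
    rw [Phi_large (k * 2) (w a) _ (hw.le_top a) (2 * j) (by omega)]
    exact Phi_large (k * 2) _ _ (hw'.le_top a) (2 * j) (by omega)
  | succ d ih =>
    intro j hj
    obtain ⟨s, r, h⟩ := Phi_pair k hk j
    have ih' := ih (j + 1) (by omega)
    rw [show 2 * (j + 1) = 2 * j + 2 by ring] at ih'
    rw [(h _).2, (h _).2, ih']
    rcases xfer_cell hl1 hl2 hm1 hm2 hw r s with h1 | ⟨x, y, -, h1⟩
    · obtain ⟨p, q⟩ := h1 a
      simp only [p, q]
    · obtain ⟨p, q, p', q'⟩ := h1 a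
      simp only [p, q, p', q']
      omega

lemma xfer_good (hl1 : Pt k l1) (hl2 : Pt k l2) (hm1 : Pt k m1) (hm2 : Pt k m2)
    {w : ℕ → ℕ → ℕ} (hw : Chain N (il m1 m2) (il l1 l2) w) (hg : Good N (k * 2) w) :
    Good N (k * 2) (xfer N (F0 l1 l2 m1 m2) w) := by
  rcases Nat.eq_zero_or_pos k with rfl | hk
  · intro τ i _; simp [Phi]
  intro τ i hi
  have ev := xfer_Phi_even hl1 hl2 hm1 hm2 hw
  rcases Nat.even_or_odd' τ with ⟨j, rfl | rfl⟩
  · rw [ev, ev, ev]; exact hg _ i hi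
  · obtain ⟨s, r, h⟩ := Phi_pair k hk j
    have e1 := fun a => (h (xfer N (F0 l1 l2 m1 m2) w a)).1
    have e2 := fun a => (h (w a)).1
    have e3 := fun a => (h (w a)).2
    have ev' := fun a => ev a (j + 1)
    simp only [show 2 * (j + 1) = 2 * j + 2 by ring] at ev'
    simp only [ev'] at e1
    have g0 := hg (2 * j) i hi
    have g1 := hg (2 * j + 1) i hi
    have g2 := hg (2 * j + 2) i hi
    rw [e1, e1, e1]
    rw [e2, e2, e2] at g1
    rw [e3, e3, e3] at g0
    rcases xfer_cell hl1 hl2 hm1 hm2 hw r s with h1 | ⟨x, y, hxy, h1⟩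
    · simp only [(h1 _).1]
      exact g1
    · simp only [(h1 _).1, (h1 _).2.1] at g0 g1
      simp only [(h1 _).2.2.1]
      rw [min_eq_left (by omega), min_eq_left (by omega), min_eq_left (by omega)] at g0 g1 ⊢
      split_ifs at g0 g1 ⊢ <;> omega

end main

lemma Pt.max {k : ℕ} {u v : ℕ → ℕ} (hu : Pt k u) (hv : Pt k v) : Pt k (fun r => max (u r) (v r)) :=
  ⟨fun _ _ h => max_le_max (hu.anti h) (hv.anti h), fun j hj => by simp [hu.zero j hj, hv.zero j hj]⟩

lemma Pt.min {k : ℕ} {u v : ℕ → ℕ} (hu : Pt k u) (hv : Pt k v) : Pt k (fun r => min (u r) (v r)) :=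
  ⟨fun _ _ h => min_le_min (hu.anti h) (hv.anti h), fun j hj => by simp [hu.zero j hj]⟩

theorem pair_thm {N k : ℕ} {l1 l2 m1 m2 : ℕ → ℕ} (hl1 : Pt k l1) (hl2 : Pt k l2)
    (hm1 : Pt k m1) (hm2 : Pt k m2) :
    skewSchur N k (fun r => max (l1 r) (l2 r)) (fun r => max (m1 r) (m2 r)) *
      skewSchur N k (fun r => min (l1 r) (l2 r)) (fun r => min (m1 r) (m2 r))
      - skewSchur N k l1 m1 * skewSchur N k l2 m2 ∈ Cone N := by
  classical
  rw [LR hl1 hl2 hm1 hm2, LR (hl1.max hl2) (hl1.min hl2) (hm1.max hm2) (hm1.min hm2)]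
  set A := (chains (k * 2) (il m1 m2) N (il l1 l2)).filter (fun w => Good N (k * 2) w) with hA
  set B := (chains (k * 2) (il (fun r => max (m1 r) (m2 r)) (fun r => min (m1 r) (m2 r))) N
    (il (fun r => max (l1 r) (l2 r)) (fun r => min (l1 r) (l2 r)))).filter (fun w => Good N (k * 2) w) with hB
  have mA : ∀ w, w ∈ A ↔ Chain N (il m1 m2) (il l1 l2) w ∧ Good N (k * 2) w := by
    intro w; rw [hA, mem_filter, mem_chains N (hl1.il_zero hl2)]
  have mB : ∀ w, w ∈ B ↔ Chain N (il (fun r => max (m1 r) (m2 r)) (fun r => min (m1 r) (m2 r)))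
    (il (fun r => max (l1 r) (l2 r)) (fun r => min (l1 r) (l2 r))) w ∧ Good N (k * 2) w := by
    intro w; rw [hB, mem_filter, mem_chains N ((hl1.max hl2).il_zero (hl1.min hl2))]
  have hsub : A.image (xfer N (F0 l1 l2 m1 m2)) ⊆ B := by
    intro v hv
    rw [mem_image] at hv
    obtain ⟨w, hw, rfl⟩ := hv
    rw [mA] at hw
    rw [mB]
    exact ⟨(arr_new hl1 hl2 hm1 hm2 hw.1).chain, xfer_good hl1 hl2 hm1 hm2 hw.1 hw.2⟩
  have hinj : Set.InjOn (xfer N (F0 l1 l2 m1 m2)) A := by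
    intro w hw w' hw' e
    have hw := (mA w).1 hw
    have hw' := (mA w').1 hw'
    exact xfer_inj hl1 hl2 hm1 hm2 hw.1 hw'.1 e
  have hwt : ∀ w ∈ A, wt (k * 2) (xfer N (F0 l1 l2 m1 m2) w) = wt (k * 2) w := by
    intro w hw
    rw [mA] at hw
    funext j
    have ev := fun a => xfer_Phi_even hl1 hl2 hm1 hm2 hw.1 a 0
    simp only [mul_zero, Phi_zero] at ev
    unfold wt
    rw [ev, ev]
  have hs : ∑ w ∈ A, skewSchur N N (wt (k * 2) w) (fun _ => 0) =
      ∑ w ∈ A.image (xfer N (F0 l1 l2 m1 m2)), skewSchur N N (wt (k * 2) w) (fun _ => 0) := by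
    rw [Finset.sum_image hinj]
    exact Finset.sum_congr rfl fun w hw => by rw [hwt w hw]
  rw [hs, ← Finset.sum_sdiff hsub, add_sub_cancel_right]
  apply AddSubmonoid.sum_mem
  intro w hw
  have hw := (mB w).1 (mem_sdiff.1 hw).1
  have h := Good.antitone hw.1 hw.2
  exact AddSubmonoid.subset_closure ⟨_, ⟨h.1, h.2⟩, rfl⟩

end SB

namespace SB
open Finset

lemma skewSchur_congr {N k : ℕ} {l l' m m' : ℕ → ℕ}
    (h : ∀ i j, i < k → j < k → (l i : ℤ) - m j = (l' i : ℤ) - m' j) :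
    skewSchur N k l m = skewSchur N k l' m' := by
  unfold skewSchur
  congr 1
  ext1 i j
  simp only [Matrix.of_apply]
  rw [h i j i.2 j.2]

/-- A local move on a pair of partitions of a tuple, acting rowwise. -/
structure Move (N k : ℕ) (f g : ℕ → ℕ → ℕ) : Prop where
  sum : ∀ a b, f a b + g a b = a + b
  pt1 : ∀ {u v : ℕ → ℕ}, Pt k u → Pt k v → Pt k (fun r => f (u r) (v r))
  pt2 : ∀ {u v : ℕ → ℕ}, Pt k u → Pt k v → Pt k (fun r => g (u r) (v r))
  pot : ∀ n j j' a b, j < j' → j' < n → f a b ≠ a →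
    (n * f a b ^ 2 + j * f a b) + (n * g a b ^ 2 + j' * g a b)
      < (n * a ^ 2 + j * a) + (n * b ^ 2 + j' * b)
  cone : ∀ {l1 l2 m1 m2 : ℕ → ℕ}, Pt k l1 → Pt k l2 → Pt k m1 → Pt k m2 →
    skewSchur N k (fun r => f (l1 r) (l2 r)) (fun r => f (m1 r) (m2 r))
      * skewSchur N k (fun r => g (l1 r) (l2 r)) (fun r => g (m1 r) (m2 r))
      - skewSchur N k l1 m1 * skewSchur N k l2 m2 ∈ Cone N

lemma moveA (N k : ℕ) : Move N k (fun a b => max a b) (fun a b => min a b) where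
  sum a b := by omega
  pt1 hu hv := hu.max hv
  pt2 hu hv := hu.min hv
  pot n j j' a b hj hn h := by
    have hab : a < b := by omega
    rw [max_eq_right hab.le, min_eq_left hab.le]
    nlinarith
  cone h1 h2 h3 h4 := pair_thm h1 h2 h3 h4

/-- Increase the first `k` rows by one. -/
def bump (k : ℕ) (u : ℕ → ℕ) : ℕ → ℕ := fun r => if r < k then u r + 1 else 0

lemma Pt.bump {k : ℕ} {u : ℕ → ℕ} (hu : Pt k u) : Pt k (bump k u) where
  anti a b hab := by
    have := hu.anti hab
    unfold SB.bump
    split_ifs <;> omega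
  zero j hj := by unfold SB.bump; rw [if_neg (by omega)]

lemma moveB (N k : ℕ) : Move N k (fun a b => min a (b + 1)) (fun a b => max a (b + 1) - 1) where
  sum a b := by omega
  pt1 {u v} hu hv := by
    refine ⟨fun a b hab => ?_, fun j hj => ?_⟩
    · have := hu.anti hab
      have := hv.anti hab
      omega
    · simp only [hu.zero j hj]; omega
  pt2 {u v} hu hv := by
    refine ⟨fun a b hab => ?_, fun j hj => ?_⟩
    · have := hu.anti hab
      have := hv.anti hab
      omega
    · simp only [hu.zero j hj, hv.zero j hj]; omega
  pot n j j' a b hj hn h := by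
    have hab : b + 2 ≤ a := by omega
    obtain ⟨e, rfl⟩ := Nat.exists_eq_add_of_le hab
    rw [min_eq_right (by omega), max_eq_left (by omega), show b + 2 + e - 1 = b + 1 + e by omega]
    obtain ⟨t, rfl⟩ := Nat.exists_eq_add_of_lt hj
    obtain ⟨q, rfl⟩ := Nat.exists_eq_add_of_lt hn
    ring_nf
    nlinarith [Nat.zero_le (t * e), Nat.zero_le (j * e), Nat.zero_le (q * e)]
  cone {l1 l2 m1 m2} h1 h2 h3 h4 := by
    have h := pair_thm (N := N) h1 h2.bump h3 h4.bump
    have e1 : skewSchur N k (bump k l2) (bump k m2) = skewSchur N k l2 m2 :=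
      skewSchur_congr fun i j hi hj => by simp [bump, hi, hj]
    have e2 : skewSchur N k (fun r => max (l1 r) (bump k l2 r)) (fun r => max (m1 r) (bump k m2 r))
        = skewSchur N k (fun r => max (l1 r) (l2 r + 1) - 1) (fun r => max (m1 r) (m2 r + 1) - 1) :=
      skewSchur_congr fun i j hi hj => by simp only [bump, hi, hj, if_true]; omega
    have e3 : skewSchur N k (fun r => min (l1 r) (bump k l2 r)) (fun r => min (m1 r) (bump k m2 r))
        = skewSchur N k (fun r => min (l1 r) (l2 r + 1)) (fun r => min (m1 r) (m2 r + 1)) :=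
      skewSchur_congr fun i j hi hj => by simp only [bump, hi, hj, if_true]
    rw [e1, e2, e3] at h
    rwa [mul_comm (skewSchur N k (fun r => min (l1 r) (l2 r + 1)) _)]

lemma prod_split {n : ℕ} {R : Type*} [CommMonoid R] (G : Fin n → R) {j j' : Fin n} (h : j ≠ j') :
    ∏ i, G i = G j * G j' * ∏ i ∈ (univ.erase j).erase j', G i := by
  rw [mul_assoc, mul_prod_erase _ _ (by simp [h.symm]), mul_prod_erase _ _ (mem_univ _)]

lemma sum_split {n : ℕ} (G : Fin n → ℕ) {j j' : Fin n} (h : j ≠ j') :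
    ∑ i, G i = G j + G j' + ∑ i ∈ (univ.erase j).erase j', G i := by
  rw [add_assoc, add_sum_erase _ _ (by simp [h.symm]), add_sum_erase _ _ (mem_univ _)]

/-- Apply a move to the entries `j`, `j'` of a tuple. -/
def act {n : ℕ} (f g : ℕ → ℕ → ℕ) (j j' : Fin n) (L : Fin n → ℕ → ℕ) : Fin n → ℕ → ℕ :=
  fun i r => if i = j then f (L j r) (L j' r) else if i = j' then g (L j r) (L j' r) else L i r

section act
variable {N k n : ℕ} {f g : ℕ → ℕ → ℕ} {j j' : Fin n} {L M : Fin n → ℕ → ℕ}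

lemma act_fst : act f g j j' L j = fun r => f (L j r) (L j' r) := by
  funext r; simp [act]

lemma act_snd (h : j ≠ j') : act f g j j' L j' = fun r => g (L j r) (L j' r) := by
  funext r; simp [act, h.symm]

lemma act_other {i : Fin n} (h : i ≠ j) (h' : i ≠ j') : act f g j j' L i = L i := by
  funext r; simp [act, h, h']

lemma act_pt (hm : Move N k f g) (hL : ∀ i, Pt k (L i)) (i : Fin n) : Pt k (act f g j j' L i) := by
  by_cases h : i = j
  · subst h; rw [act_fst]; exact hm.pt1 (hL _) (hL _)
  · by_cases h' : i = j'
    · subst h'; rw [act_snd (Ne.symm h)]; exact hm.pt2 (hL _) (hL _)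
    · rw [act_other h h']; exact hL i

lemma act_sum (hm : Move N k f g) (h : j ≠ j') (r : ℕ) :
    ∑ i, act f g j j' L i r = ∑ i, L i r := by
  rw [sum_split _ h, sum_split (fun i => L i r) h, act_fst, act_snd h]
  simp only [hm.sum]
  congr 1
  refine sum_congr rfl fun i hi => ?_
  simp only [mem_erase] at hi
  rw [act_other hi.2.1 hi.1]

def pot1 (n : ℕ) (L : Fin n → ℕ → ℕ) (r : ℕ) : ℕ := ∑ i : Fin n, (n * L i r ^ 2 + i * L i r)

def potT (n k : ℕ) (L : Fin n → ℕ → ℕ) : ℕ := ∑ r ∈ range k, pot1 n L r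

lemma pot1_lt (hm : Move N k f g) (h : j < j') (r : ℕ) (hr : f (L j r) (L j' r) ≠ L j r) :
    pot1 n (act f g j j' L) r < pot1 n L r := by
  unfold pot1
  rw [sum_split _ h.ne, sum_split (fun i : Fin n => n * L i r ^ 2 + i * L i r) h.ne, act_fst,
    act_snd h.ne]
  have e : ∑ i ∈ (univ.erase j).erase j', (n * act f g j j' L i r ^ 2 + i * act f g j j' L i r)
      = ∑ i ∈ (univ.erase j).erase j', (n * L i r ^ 2 + i * L i r) := by
    refine sum_congr rfl fun i hi => ?_
    simp only [mem_erase] at hi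
    rw [act_other hi.2.1 hi.1]
  rw [e]
  have := hm.pot n j j' (L j r) (L j' r) h j'.2 hr
  simp only at this ⊢
  omega

lemma pot1_le (hm : Move N k f g) (h : j < j') (r : ℕ) :
    pot1 n (act f g j j' L) r ≤ pot1 n L r := by
  by_cases hr : f (L j r) (L j' r) = L j r
  · have hs : g (L j r) (L j' r) = L j' r := by
      have := hm.sum (L j r) (L j' r); omega
    refine le_of_eq (sum_congr rfl fun i _ => ?_)
    have : act f g j j' L i r = L i r := by
      unfold act; split_ifs with h1 h2
      · rw [hr, h1]
      · rw [hs, h2]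
      · rfl
    rw [this]
  · exact (pot1_lt hm h r hr).le

lemma potT_le (hm : Move N k f g) (h : j < j') : potT n k (act f g j j' L) ≤ potT n k L :=
  sum_le_sum fun r _ => pot1_le hm h r

lemma potT_lt (hm : Move N k f g) (hL : ∀ i, Pt k (L i)) (h : j < j') (r : ℕ)
    (hr : f (L j r) (L j' r) ≠ L j r) : potT n k (act f g j j' L) < potT n k L := by
  refine sum_lt_sum (fun r _ => pot1_le hm h r) ⟨r, ?_, pot1_lt hm h r hr⟩
  by_contra hk
  rw [mem_range, not_lt] at hk
  rw [(hL j).zero r hk, (hL j').zero r hk] at hr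
  have := hm.sum 0 0
  omega

lemma Cone_prod {ι : Type*} (s : Finset ι) (F : ι → MvPolynomial (Fin N) ℤ)
    (h : ∀ i ∈ s, F i ∈ Cone N) : ∏ i ∈ s, F i ∈ Cone N :=
  prod_induction F (fun x => x ∈ Cone N) (fun _ _ => Cone.mul) Cone.one h

lemma act_cone (hm : Move N k f g) (h : j ≠ j') (hL : ∀ i, Pt k (L i)) (hM : ∀ i, Pt k (M i)) :
    ∏ i, skewSchur N k (act f g j j' L i) (act f g j j' M i) - ∏ i, skewSchur N k (L i) (M i)
      ∈ Cone N := by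
  rw [prod_split _ h, prod_split (fun i => skewSchur N k (L i) (M i)) h, act_fst, act_snd h,
    act_fst, act_snd h]
  have e : ∏ i ∈ (univ.erase j).erase j', skewSchur N k (act f g j j' L i) (act f g j j' M i)
      = ∏ i ∈ (univ.erase j).erase j', skewSchur N k (L i) (M i) := by
    refine prod_congr rfl fun i hi => ?_
    simp only [mem_erase] at hi
    rw [act_other hi.2.1 hi.1, act_other hi.2.1 hi.1]
  rw [e, ← sub_mul]
  exact Cone.mul (hm.cone (hL _) (hL _) (hM _) (hM _)) (Cone_prod _ _ fun i _ => mem_Cone (hL i) (hM i))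

end act

/-- The balanced tuple with given column sums. -/
def bal {n : ℕ} (L : Fin n → ℕ → ℕ) (i : Fin n) : ℕ → ℕ :=
  fun r => (∑ i, L i r + (n - 1 - i)) / n

lemma bal_eq {n : ℕ} (x : Fin n → ℕ) (h : ∀ j j' : Fin n, j < j' → x j' ≤ x j ∧ x j ≤ x j' + 1)
    (j : Fin n) : (∑ i, x i + (n - 1 - j)) / n = x j := by
  have hj := j.2
  have h1 : ∑ i, x i ≤ ∑ i : Fin n, (x j + if i < j then 1 else 0) := by
    refine sum_le_sum fun i _ => ?_
    split_ifs with hi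
    · exact (h i j hi).2
    · rcases (not_lt.1 hi).eq_or_lt with e | e
      · rw [e]; simp
      · simpa using (h j i e).1
  have h2 : ∑ i : Fin n, x j ≤ ∑ i : Fin n, (x i + if j < i then 1 else 0) := by
    refine sum_le_sum fun i _ => ?_
    split_ifs with hi
    · exact (h j i hi).2
    · rcases (not_lt.1 hi).eq_or_lt with e | e
      · rw [e]; simp
      · simpa using (h i j e).1
  have c1 : ∑ i : Fin n, (if i < j then 1 else 0) = (j : ℕ) := by
    rw [← card_filter, Finset.filter_gt_eq_Iio, Fin.card_Iio]
  have c2 : ∑ i : Fin n, (if j < i then 1 else 0) = n - 1 - (j : ℕ) := by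
    rw [← card_filter, Finset.filter_lt_eq_Ioi, Fin.card_Ioi]
  rw [sum_add_distrib, c1] at h1
  rw [sum_add_distrib, c2] at h2
  simp only [sum_const, card_univ, Fintype.card_fin, smul_eq_mul] at h1 h2
  refine Nat.div_eq_of_lt_le ?_ ?_
  · rw [mul_comm]; exact h2
  · rw [mul_comm, mul_add, mul_one]; omega

theorem tuple_thm {N k n : ℕ} (p : ℕ) : ∀ (L M : Fin n → ℕ → ℕ), potT n k L + potT n k M = p →
    (∀ i, Pt k (L i)) → (∀ i, Pt k (M i)) →
    ∏ i, skewSchur N k (bal L i) (bal M i) - ∏ i, skewSchur N k (L i) (M i) ∈ Cone N := by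
  induction p using Nat.strong_induction_on with
  | _ p ih =>
  intro L M hp hL hM
  have key : ∀ f g : ℕ → ℕ → ℕ, Move N k f g → ∀ j j' : Fin n, j < j' → ∀ r,
      (f (L j r) (L j' r) ≠ L j r ∨ f (M j r) (M j' r) ≠ M j r) →
      ∏ i, skewSchur N k (bal L i) (bal M i) - ∏ i, skewSchur N k (L i) (M i) ∈ Cone N := by
    intro f g hm j j' hj r hr
    have hlt : potT n k (act f g j j' L) + potT n k (act f g j j' M) < p := by
      rw [← hp]
      rcases hr with hr | hr
      · exact add_lt_add_of_lt_of_le (potT_lt hm hL hj r hr) (potT_le hm hj)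
      · exact add_lt_add_of_le_of_lt (potT_le hm hj) (potT_lt hm hM hj r hr)
    have h1 := ih _ hlt _ _ rfl (act_pt hm hL) (act_pt hm hM)
    have h2 := act_cone hm hj.ne hL hM
    have e : ∀ L : Fin n → ℕ → ℕ, bal (act f g j j' L) = bal L := by
      intro L; funext i r; unfold bal; rw [act_sum hm hj.ne]
    rw [e, e] at h1
    have := (Cone N).add_mem h1 h2
    rwa [sub_add_sub_cancel] at this
  by_contra hcon
  have hA : ∀ j j' : Fin n, j < j' → ∀ r, L j' r ≤ L j r ∧ M j' r ≤ M j r := by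
    intro j j' hj r
    by_contra hh
    refine hcon (key _ _ (moveA N k) j j' hj r ?_)
    omega
  have hB : ∀ j j' : Fin n, j < j' → ∀ r, L j r ≤ L j' r + 1 ∧ M j r ≤ M j' r + 1 := by
    intro j j' hj r
    by_contra hh
    refine hcon (key _ _ (moveB N k) j j' hj r ?_)
    omega
  have eL : bal L = L := by
    funext i r
    exact bal_eq (fun i => L i r) (fun j j' h => ⟨(hA j j' h r).1, (hB j j' h r).1⟩) i
  have eM : bal M = M := by
    funext i r
    exact bal_eq (fun i => M i r) (fun j j' h => ⟨(hA j j' h r).2, (hB j j' h r).2⟩) i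
  apply hcon
  rw [eL, eM, sub_self]
  exact (Cone N).zero_mem

lemma le_conjPart {k : ℕ} {lam : ℕ → ℕ} (h : Pt k lam) (q r : ℕ) :
    r + 1 ≤ conjPart lam q ↔ q + 1 ≤ lam r := by
  unfold conjPart
  have hfin : Set.Finite {i : ℕ | q + 1 ≤ lam i} := by
    refine (Set.finite_Iio k).subset fun i hi => ?_
    have hi' : q + 1 ≤ lam i := hi
    by_contra hk
    have := h.zero i (not_lt.1 hk)
    omega
  constructor
  · intro h1
    by_contra h2
    have hs : {i : ℕ | q + 1 ≤ lam i} ⊆ Set.Iio r := by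
      intro i hi
      have hi' : q + 1 ≤ lam i := hi
      by_contra hk
      have := h.anti (not_lt.1 hk)
      omega
    have := Set.ncard_le_ncard hs (Set.finite_Iio r)
    rw [Set.ncard_Iio_nat] at this
    omega
  · intro h1
    have hs : Set.Iio (r + 1) ⊆ {i : ℕ | q + 1 ≤ lam i} := by
      intro i hi
      have hi' : i < r + 1 := hi
      have := h.anti (show i ≤ r by omega)
      exact h1.trans this
    have := Set.ncard_le_ncard hs hfin
    rwa [Set.ncard_Iio_nat] at this

lemma braceQuot_eq {k n : ℕ} {lam : ℕ → ℕ} (h : Pt k lam) (i : Fin n) :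
    braceQuot n i lam = fun r => (lam r + (n - 1 - i)) / n := by
  funext r
  have hi := i.2
  have hn : 0 < n := by omega
  unfold braceQuot
  rw [conjPart]
  have e : {j : ℕ | r + 1 ≤ conjPart lam (i + j * n)} = Set.Iio ((lam r + (n - 1 - i)) / n) := by
    ext j
    refine (le_conjPart h _ _).trans ?_
    rw [Set.mem_Iio, ← Nat.succ_le_iff, Nat.le_div_iff_mul_le hn, Nat.succ_mul]
    omega
  rw [e, Set.ncard_Iio_nat]

theorem main {c d k N : ℕ} {lam mu nu rho : ℕ → ℕ} (h1 : Pt k lam) (h2 : Pt k mu) (h3 : Pt k nu)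
    (h4 : Pt k rho) :
    ∏ i : Fin (c + d),
          skewSchur N k (braceQuot (c + d) i (fun j => c * lam j + d * nu j))
            (braceQuot (c + d) i (fun j => c * mu j + d * rho j))
        - skewSchur N k lam mu ^ c * skewSchur N k nu rho ^ d ∈ Cone N := by
  have hpt : ∀ {u v : ℕ → ℕ}, Pt k u → Pt k v → Pt k (fun j => c * u j + d * v j) := by
    intro u v hu hv
    refine ⟨fun a b hab => ?_, fun j hj => ?_⟩
    · exact add_le_add (Nat.mul_le_mul_left _ (hu.anti hab)) (Nat.mul_le_mul_left _ (hv.anti hab))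
    · simp only [hu.zero j hj, hv.zero j hj, mul_zero, add_zero]
  let T : (ℕ → ℕ) → (ℕ → ℕ) → Fin (c + d) → ℕ → ℕ := fun u v =>
    Fin.addCases (fun _ => u) (fun _ => v)
  have hT : ∀ {u v : ℕ → ℕ}, Pt k u → Pt k v → ∀ i, Pt k (T u v i) := by
    intro u v hu hv i
    refine Fin.addCases (fun i => ?_) (fun i => ?_) i
    · simpa [T] using hu
    · simpa [T] using hv
  have hb : ∀ {u v : ℕ → ℕ}, Pt k u → Pt k v → ∀ i,
      braceQuot (c + d) i (fun j => c * u j + d * v j) = bal (T u v) i := by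
    intro u v hu hv i
    rw [braceQuot_eq (hpt hu hv)]
    funext r
    unfold bal
    rw [Fin.sum_univ_add]
    simp [T]
  have := tuple_thm (N := N) _ (T lam nu) (T mu rho) rfl (hT h1 h3) (hT h2 h4)
  rw [Fin.prod_univ_add (fun i => skewSchur N k (T lam nu i) (T mu rho i))] at this
  simp only [T, Fin.addCases_left, Fin.addCases_right, prod_const, card_univ, Fintype.card_fin] at this
  simp only [hb h1 h3, hb h2 h4]
  exact this

end SB
/-- Let `c, d` be positive integers, `n = c + d`, and let `λ/μ`, `ν/ρ` be two
skew shapes (with at most `k` parts). With `α = cλ + dν` and `β = cμ + dρ`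
(coordinatewise), `∏_{i=1}^n s_{α^{{i,n}}/β^{{i,n}}} ≥_s s_{λ/μ}^c s_{ν/ρ}^d`. -/
theorem schur_nonneg_brace_power (c d : ℕ) (hc : 1 ≤ c) (hd : 1 ≤ d)
    (k : ℕ) (lam mu nu rho : ℕ → ℕ)
    (hlam : Antitone lam) (hmu : Antitone mu) (hnu : Antitone nu) (hrho : Antitone rho)
    (hlamk : ∀ j, k ≤ j → lam j = 0) (hmuk : ∀ j, k ≤ j → mu j = 0)
    (hnuk : ∀ j, k ≤ j → nu j = 0) (hrhok : ∀ j, k ≤ j → rho j = 0)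
    (hml : ∀ i, mu i ≤ lam i) (hrn : ∀ i, rho i ≤ nu i)
    (N : ℕ) :
    IsSchurNonneg N
      (∏ i : Fin (c + d),
          skewSchur N k (braceQuot (c + d) i (fun j => c * lam j + d * nu j))
            (braceQuot (c + d) i (fun j => c * mu j + d * rho j))
        - skewSchur N k lam mu ^ c * skewSchur N k nu rho ^ d) := by
  exact SB.Cone.nonneg (SB.main ⟨hlam, hlamk⟩ ⟨hmu, hmuk⟩ ⟨hnu, hnuk⟩ ⟨hrho, hrhok⟩)
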